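/- Assume B : (0,∞) → [0,∞) is continuous and bounded on some neighborhood of 0 and satisfies (A2), and let U be a continuously differentiable Perron eigenfunction. Let µ₀ = µ₀⁺ − µ₀⁻ be a weighted signed measure and set µ_t := µ₀⁺M_t − µ₀⁻M_t. Then there exists a family (ρ_t)_{t≥0} of weighted signed measures with ρ_{t + log 2} = ρ_t for all t ≥ 0 such that for every continuous f : (0,∞) → ℝ with f(x)/x → 0 as x → 0 and as x → ∞, e^{−t} µ_t(f) − ρ_t(f) → 0 as t → ∞; this family is unique in the sense that any two such log 2-periodic families have equal action on all such f. Moreover, for every t ≥ 0 and every continuously differentiable compactly supported f : (0,∞) → ℝ, ρ_t(f) = lim_{N→∞} Σ_{k=−N}^{N} (1 − |k|/N) µ₀(φ_k) ν_k(f) e^{2ikπt/log 2}. -/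

import Mathlib

open MeasureTheory Real Set Filter Topology

noncomputable section

/-- A function on `(0,∞)` is locally bounded if it is bounded on the intersection of
`(0,∞)` with every bounded set. -/
def LocBddOn (f : ℝ → ℝ) : Prop :=
  ∀ r > 0, ∃ C, ∀ x, 0 < x → x ≤ r → |f x| ≤ C

/-- A function on `[0,∞) × (0,∞)` is locally bounded if it is bounded on the intersection of
`[0,∞) × (0,∞)` with every bounded set. -/
def LocBdd2 (φ : ℝ → ℝ → ℝ) : Prop :=
  ∀ r > 0, ∃ C, ∀ t x, 0 ≤ t → t ≤ r → 0 < x → x ≤ r → |φ t x| ≤ C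

/-- Mild solution of the dual mitosis equation with initial datum `f`. -/
def IsMildSol (B f : ℝ → ℝ) (φ : ℝ → ℝ → ℝ) : Prop :=
  ∀ t ≥ 0, ∀ x > 0,
    φ t x = f (x * exp t) * Real.exp (-∫ s in (0:ℝ)..t, B (x * exp s))
      + 2 * ∫ τ in (0:ℝ)..t,
          B (x * exp τ) * Real.exp (-∫ s in (0:ℝ)..τ, B (x * exp s)) * φ (t - τ) (x * exp τ / 2)

/-- `B : (0,∞) → [0,∞)` is continuous and bounded on some neighborhood of `0`. -/
def Bhyp (B : ℝ → ℝ) : Prop :=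
  ContinuousOn B (Ioi 0) ∧ (∀ x > 0, 0 ≤ B x) ∧
    ∃ ε > 0, ∃ C, ∀ x, 0 < x → x < ε → B x ≤ C

/-- Assumption (A2) on the division rate: local integrability, support `[b,∞)`,
power-law bound near `0` and two-sided power-law bounds at infinity. -/
def HypA2 (B : ℝ → ℝ) : Prop :=
  (∀ a b : ℝ, 0 < a → IntegrableOn B (Icc a b)) ∧
  (∃ b ≥ (0:ℝ), closure {x : ℝ | 0 < x ∧ B x ≠ 0} = Ici b) ∧
  (∃ b₀ > (0:ℝ), ∃ γ₀ > (0:ℝ), ∃ K₀ > (0:ℝ), ∀ x, 0 < x → x < b₀ → B x ≤ K₀ * x ^ γ₀) ∧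
  (∃ b₁ > (0:ℝ), ∃ γ₁ > (0:ℝ), ∃ γ₂ > (0:ℝ), ∃ K₁ > (0:ℝ), ∃ K₂ > (0:ℝ),
    ∀ x, b₁ < x → K₁ * x ^ γ₁ ≤ B x ∧ B x ≤ K₂ * x ^ γ₂)

/-- `U` is a continuously differentiable Perron eigenfunction (with derivative `U'`):
nonnegative, solves `(xU)' + (B+1)U = 4B(2x)U(2x)`, is normalized by `∫ x U = 1`,
and `x^r U` is bounded and integrable on `(0,∞)` for every real `r`. -/
def Perron (B U U' : ℝ → ℝ) : Prop :=
  (∀ x > 0, 0 ≤ U x) ∧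
  (∀ x > 0, HasDerivAt U (U' x) x) ∧
  ContinuousOn U' (Ioi 0) ∧
  (∀ x > 0, (U x + x * U' x) + (B x + 1) * U x = 4 * B (2 * x) * U (2 * x)) ∧
  (∫ x in Ioi (0:ℝ), x * U x) = 1 ∧
  (∀ r : ℝ, (∃ C, ∀ x > 0, x ^ r * U x ≤ C) ∧ IntegrableOn (fun x => x ^ r * U x) (Ioi 0))

/-- The boundary eigenvalue `λ_k = 1 + 2ikπ/log 2`. -/
def lambdak (k : ℤ) : ℂ :=
  1 + Complex.I * ((2 * (k : ℝ) * Real.pi / Real.log 2 : ℝ) : ℂ)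

/-- The adjoint boundary eigenfunction `φ_k(x) = x · exp((2ikπ/log 2) log x)`. -/
def phik (k : ℤ) (x : ℝ) : ℂ :=
  (x : ℂ) * Complex.exp (Complex.I * ((2 * (k : ℝ) * Real.pi / Real.log 2 : ℝ) : ℂ)
      * (Real.log x : ℂ))

/-- The boundary eigenfunction `U_k(x) = exp(-(2ikπ/log 2) log x) U(x)`. -/
def Uk (U : ℝ → ℝ) (k : ℤ) (x : ℝ) : ℂ :=
  Complex.exp (-(Complex.I * ((2 * (k : ℝ) * Real.pi / Real.log 2 : ℝ) : ℂ))
      * (Real.log x : ℂ)) * (U x : ℂ)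

/-- The linear form `ν_k(f) = ∫₀^∞ U_k(x) f(x) dx` (complex-valued `f`). -/
def nuk (U : ℝ → ℝ) (k : ℤ) (f : ℝ → ℂ) : ℂ :=
  ∫ x in Ioi (0:ℝ), Uk U k x * f x

namespace Mit

/-- cumulative rate -/
def Acc (b : ℝ → ℝ) (y t : ℝ) : ℝ := ∫ s in (0:ℝ)..t, b (y + s)

lemma Acc_hasDerivAt {b : ℝ → ℝ} (hb : Continuous b) (y t : ℝ) :
    HasDerivAt (Acc b y) (b (y + t)) t := by
  have hc : Continuous (fun s => b (y + s)) := by fun_prop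
  exact intervalIntegral.integral_hasDerivAt_right (hc.intervalIntegrable _ _)
    (hc.stronglyMeasurableAtFilter _ _) hc.continuousAt

lemma Acc_zero (b : ℝ → ℝ) (y : ℝ) : Acc b y 0 = 0 := by simp [Acc]

lemma Acc_continuous {b : ℝ → ℝ} (hb : Continuous b) :
    Continuous (fun q : ℝ × ℝ => Acc b q.1 q.2) := by
  unfold Acc
  exact intervalIntegral.continuous_parametric_intervalIntegral_of_continuous
    (f := fun (q : ℝ × ℝ) s => b (q.1 + s)) (by unfold Function.uncurry; fun_prop) continuous_snd

lemma Acc_continuous' {b : ℝ → ℝ} (hb : Continuous b) (y : ℝ) : Continuous (Acc b y) :=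
  (Acc_continuous hb).comp (by fun_prop : Continuous fun t : ℝ => (y, t))

/-- ODE comparison. -/
lemma ode_nonneg {b : ℝ → ℝ} (hb : Continuous b) (y : ℝ) {E E' : ℝ → ℝ}
    (hE : ∀ t, 0 ≤ t → HasDerivAt E (E' t) t) (h : ∀ t, 0 ≤ t → -(b (y + t)) * E t ≤ E' t)
    (h0 : 0 ≤ E 0) (t : ℝ) (ht : 0 ≤ t) : 0 ≤ E t := by
  have hd : ∀ s, 0 ≤ s → HasDerivAt (fun s => E s * exp (Acc b y s))
      (E' s * exp (Acc b y s) + E s * (exp (Acc b y s) * b (y + s))) s := fun s hs =>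
    (hE s hs).mul (Acc_hasDerivAt hb y s).exp
  have hm : MonotoneOn (fun s => E s * exp (Acc b y s)) (Ici 0) := by
    apply monotoneOn_of_deriv_nonneg (convex_Ici 0)
    · exact fun s hs => (hd s hs).continuousAt.continuousWithinAt
    · intro s hs
      rw [interior_Ici] at hs
      exact (hd s (le_of_lt hs)).differentiableAt.differentiableWithinAt
    · intro s hs
      rw [interior_Ici] at hs
      rw [(hd s (le_of_lt hs)).deriv]
      have := h s (le_of_lt hs)
      have h2 := exp_pos (Acc b y s)
      nlinarith
  have := hm (mem_Ici.2 le_rfl) (mem_Ici.2 ht) ht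
  simp only [Acc_zero, exp_zero, mul_one] at this
  have h3 : 0 ≤ E t * exp (Acc b y t) := h0.trans this
  exact nonneg_of_mul_nonneg_left h3 (exp_pos _)

lemma ode_unique {b : ℝ → ℝ} (hb : Continuous b) (y : ℝ) {E E' : ℝ → ℝ}
    (hE : ∀ t, 0 ≤ t → HasDerivAt E (E' t) t) (h : ∀ t, 0 ≤ t → E' t = -(b (y + t)) * E t)
    (h0 : E 0 = 0) (t : ℝ) (ht : 0 ≤ t) : E t = 0 := by
  apply le_antisymm
  · have := ode_nonneg hb y (E := fun t => - E t) (E' := fun t => - E' t)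
      (fun t ht => (hE t ht).neg) (fun t ht => by rw [h t ht]; linarith) (by simp [h0]) t ht
    linarith
  · exact ode_nonneg hb y hE (fun t ht => (h t ht).ge) h0.ge t ht

/-- probability of exactly `k` jumps up to time `t` starting from log-size `y` -/
def pk (b : ℝ → ℝ) (L : ℝ) : ℕ → ℝ → ℝ → ℝ
  | 0, y, t => exp (-Acc b y t)
  | k+1, y, t => exp (-Acc b (y - (k+1) * L) t) *
      ∫ s in (0:ℝ)..t, b (y - k * L + s) * pk b L k y s * exp (Acc b (y - (k+1) * L) s)

variable {b : ℝ → ℝ} {L : ℝ}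

lemma pk_continuous (hb : Continuous b) (k : ℕ) :
    Continuous (fun q : ℝ × ℝ => pk b L k q.1 q.2) := by
  induction k with
  | zero => exact (Acc_continuous hb).neg.rexp
  | succ k ih =>
    simp only [pk]
    refine Continuous.mul ?_ ?_
    · exact ((Acc_continuous hb).comp
        (by fun_prop : Continuous fun q : ℝ × ℝ => (q.1 - (k+1) * L, q.2))).neg.rexp
    · refine intervalIntegral.continuous_parametric_intervalIntegral_of_continuous
        (f := fun (q : ℝ × ℝ) s => b (q.1 - k * L + s) * pk b L k q.1 s *
          exp (Acc b (q.1 - (k+1) * L) s)) ?_ continuous_snd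
      unfold Function.uncurry
      refine Continuous.mul (Continuous.mul (by fun_prop) ?_) ?_
      · exact ih.comp (by fun_prop : Continuous fun p : (ℝ × ℝ) × ℝ => (p.1.1, p.2))
      · exact ((Acc_continuous hb).comp
          (by fun_prop : Continuous fun p : (ℝ × ℝ) × ℝ => (p.1.1 - (k+1) * L, p.2))).rexp

lemma pk_continuous_t (hb : Continuous b) (k : ℕ) (y : ℝ) : Continuous (pk b L k y) :=
  (pk_continuous hb k).comp (by fun_prop : Continuous fun t : ℝ => (y, t))

lemma pk_continuous_y (hb : Continuous b) (k : ℕ) (t : ℝ) : Continuous (fun y => pk b L k y t) :=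
  (pk_continuous hb k).comp (by fun_prop : Continuous fun y : ℝ => (y, t))

lemma pk_zero_zero (y : ℝ) : pk b L 0 y 0 = 1 := by simp [pk, Acc_zero]
lemma pk_succ_zero (k : ℕ) (y : ℝ) : pk b L (k+1) y 0 = 0 := by simp [pk]

lemma pk_zero_hasDerivAt (hb : Continuous b) (y t : ℝ) :
    HasDerivAt (pk b L 0 y) (-(b (y + t)) * pk b L 0 y t) t := by
  have : pk b L 0 y = fun t => exp (-Acc b y t) := by funext t; simp [pk]
  rw [this]
  refine HasDerivAt.congr_deriv (Acc_hasDerivAt hb y t).neg.exp ?_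
  simp only [Pi.neg_apply]; ring

lemma pk_succ_hasDerivAt (hb : Continuous b) (k : ℕ) (y t : ℝ) :
    HasDerivAt (pk b L (k+1) y) (b (y - k * L + t) * pk b L k y t
      - b (y - (k+1) * L + t) * pk b L (k+1) y t) t := by
  have : pk b L (k+1) y = fun t => exp (-Acc b (y - (k+1) * L) t) *
      ∫ s in (0:ℝ)..t, b (y - k * L + s) * pk b L k y s * exp (Acc b (y - (k+1) * L) s) := by
    funext t; simp [pk]
  rw [this]
  have hc : Continuous (fun s => b (y - k * L + s) * pk b L k y s *
      exp (Acc b (y - (k+1) * L) s)) := by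
    have h1 := pk_continuous_t (L := L) hb k y
    have h2 := Acc_continuous' hb (y - (k+1) * L)
    fun_prop
  have h1 := intervalIntegral.integral_hasDerivAt_right (hc.intervalIntegrable 0 t)
    (hc.stronglyMeasurableAtFilter _ _) hc.continuousAt
  refine HasDerivAt.congr_deriv ((Acc_hasDerivAt hb (y - (k+1) * L) t).neg.exp.mul h1) ?_
  simp only [Pi.neg_apply]
  have : exp (-Acc b (y - (k+1) * L) t) * exp (Acc b (y - (k+1) * L) t) = 1 := by
    rw [← exp_add]; simp
  linear_combination (b (y - k * L + t) * pk b L k y t) * this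

lemma pk_nonneg (hb : Continuous b) (hb0 : ∀ y, 0 ≤ b y) (k : ℕ) (y : ℝ) :
    ∀ t, 0 ≤ t → 0 ≤ pk b L k y t := by
  induction k with
  | zero => intro t _; simp only [pk]; positivity
  | succ k ih =>
    intro t ht
    refine ode_nonneg hb (y - (k+1) * L) (fun t _ => pk_succ_hasDerivAt hb k y t) ?_
      (by rw [pk_succ_zero]) t ht
    intro t ht
    have := mul_nonneg (hb0 (y - k * L + t)) (ih t ht)
    linarith

lemma pk_le (hb : Continuous b) (hb0 : ∀ y, 0 ≤ b y) (hL : 0 ≤ L) (y T C : ℝ)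
    (hC : ∀ z ≤ y + T, b z ≤ C) (k : ℕ) :
    ∀ t, 0 ≤ t → t ≤ T → pk b L k y t ≤ (C * t) ^ k / k.factorial := by
  have hC0 : 0 ≤ C := (hb0 _).trans (hC _ le_rfl)
  induction k with
  | zero =>
    intro t ht _
    simp only [pk, pow_zero, Nat.factorial_zero, Nat.cast_one, div_one]
    rw [exp_le_one_iff]
    have : 0 ≤ Acc b y t := intervalIntegral.integral_nonneg ht (fun s _ => hb0 _)
    linarith
  | succ k ih =>
    intro t ht htT
    have hd : ∀ s, HasDerivAt (fun s => (C * s) ^ (k+1) / (k+1).factorial - pk b L (k+1) y s)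
      (C * (C * s) ^ k / k.factorial - (b (y - k * L + s) * pk b L k y s
      - b (y - (k+1) * L + s) * pk b L (k+1) y s)) s := by
      intro s
      refine HasDerivAt.sub ?_ (pk_succ_hasDerivAt hb k y s)
      have h := ((((hasDerivAt_id s).const_mul C).pow (k+1)).div_const ((k+1).factorial : ℝ))
      refine HasDerivAt.congr_deriv h ?_
      have : (k.factorial : ℝ) ≠ 0 := by positivity
      rw [Nat.factorial_succ]
      push_cast
      simp only [id]
      field_simp
    have hm : MonotoneOn (fun s => (C * s) ^ (k+1) / (k+1).factorial - pk b L (k+1) y s)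
        (Icc 0 T) := by
      apply monotoneOn_of_deriv_nonneg (convex_Icc 0 T)
      · exact fun s _ => (hd s).continuousAt.continuousWithinAt
      · exact fun s _ => (hd s).differentiableAt.differentiableWithinAt
      · intro s hs
        rw [interior_Icc] at hs
        rw [(hd s).deriv]
        have h1 := ih s hs.1.le hs.2.le
        have hkL : 0 ≤ k * L := by positivity
        have h2 := hC (y - k * L + s) (by linarith [hs.2])
        have h3 := mul_nonneg (hb0 (y - (k+1) * L + s)) (pk_nonneg (L := L) hb hb0 (k+1) y s hs.1.le)
        have h4 : b (y - k * L + s) * pk b L k y s ≤ C * ((C * s) ^ k / k.factorial) :=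
          mul_le_mul h2 h1 (pk_nonneg hb hb0 k y s hs.1.le) hC0
        rw [mul_div_assoc]
        linarith
    have := hm ⟨le_rfl, ht.trans htT⟩ ⟨ht, htT⟩ ht
    simp only [pk_succ_zero, mul_zero, ne_eq, Nat.add_eq_zero_iff, one_ne_zero, and_false, not_false_eq_true,
      zero_pow, zero_div, sub_zero] at this
    linarith

lemma sum_pk_hasDerivAt (hb : Continuous b) (y t : ℝ) (K : ℕ) :
    HasDerivAt (fun t => ∑ k ∈ Finset.range (K+1), pk b L k y t)
      (-(b (y - K * L + t)) * pk b L K y t) t := by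
  induction K with
  | zero => simpa using pk_zero_hasDerivAt (L := L) hb y t
  | succ K ih =>
    simp_rw [Finset.sum_range_succ _ (K+1)]
    refine HasDerivAt.congr_deriv (ih.add (pk_succ_hasDerivAt hb K y t)) ?_
    push_cast; ring

lemma pk_hasSum (hb : Continuous b) (hb0 : ∀ y, 0 ≤ b y) (hbb : ∀ r, ∃ C, ∀ y ≤ r, b y ≤ C)
    (hL : 0 ≤ L) (y t : ℝ) (ht : 0 ≤ t) : HasSum (fun k => pk b L k y t) 1 := by
  obtain ⟨C, hC⟩ := hbb (y + t)
  have hC0 : 0 ≤ C := (hb0 _).trans (hC _ le_rfl)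
  rw [hasSum_iff_tendsto_nat_of_nonneg (fun k => pk_nonneg hb hb0 k y t ht)]
  rw [← tendsto_add_atTop_iff_nat 1]
  have hlim : Tendsto (fun K : ℕ => C * ((C * t) ^ K / K.factorial) * (t - 0)) atTop (𝓝 0) := by
    have := (FloorSemiring.tendsto_pow_div_factorial_atTop (C * t)).const_mul C |>.mul_const (t - 0)
    simpa using this
  rw [tendsto_iff_norm_sub_tendsto_zero]
  refine squeeze_zero (fun _ => norm_nonneg _) (fun K => ?_) hlim
  have h := norm_image_sub_le_of_norm_deriv_le_segment' (a := 0) (b := t)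
    (f := fun t => ∑ k ∈ Finset.range (K+1), pk b L k y t)
    (f' := fun t => -(b (y - K * L + t)) * pk b L K y t) (C := C * ((C * t) ^ K / K.factorial))
    (fun s _ => (sum_pk_hasDerivAt hb y s K).hasDerivWithinAt) ?_ t ⟨ht, le_rfl⟩
  · have h0 : ∑ k ∈ Finset.range (K+1), pk b L k y 0 = 1 := by
      rw [Finset.sum_range_succ']
      simp [pk_succ_zero, pk_zero_zero]
    simp only [h0] at h
    exact h
  · intro s hs
    have hkL : 0 ≤ K * L := by positivity
    rw [norm_mul, norm_neg, Real.norm_of_nonneg (hb0 _),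
      Real.norm_of_nonneg (pk_nonneg hb hb0 K y s hs.1)]
    refine mul_le_mul (hC _ (by linarith [hs.2])) ?_ (pk_nonneg hb hb0 K y s hs.1) hC0
    refine (pk_le hb hb0 hL y t C hC K s hs.1 hs.2.le).trans ?_
    have h1 : C * s ≤ C * t := mul_le_mul_of_nonneg_left hs.2.le hC0
    have h0 : 0 ≤ C * s := mul_nonneg hC0 hs.1
    gcongr

/-- Chapman–Kolmogorov -/
lemma pk_CK (hb : Continuous b) (y t : ℝ) (n : ℕ) : ∀ s, 0 ≤ s →
    pk b L n y (t + s) = ∑ j ∈ Finset.range (n+1), pk b L j y t * pk b L (n-j) (y + t - j * L) s := by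
  induction n with
  | zero =>
    intro s hs
    have := ode_unique hb (y + t) (E := fun s => pk b L 0 y (t + s) - pk b L 0 y t * pk b L 0 (y + t) s)
      (E' := fun s => -(b (y + (t + s))) * pk b L 0 y (t + s)
        - pk b L 0 y t * (-(b (y + t + s)) * pk b L 0 (y + t) s))
      (fun s _ => ((pk_zero_hasDerivAt hb y (t + s)).comp_const_add t s).sub
        ((pk_zero_hasDerivAt hb (y + t) s).const_mul _))
      (fun s _ => by rw [← add_assoc]; ring) (by simp [pk_zero_zero]) s hs
    simp only [zero_add, Finset.range_one, Finset.sum_singleton, Nat.cast_zero, zero_mul, sub_zero,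
      Nat.sub_self] at this ⊢
    linarith
  | succ n ih =>
    intro s hs
    have key : ∀ s, HasDerivAt (fun s => ∑ j ∈ Finset.range (n+1+1),
        pk b L j y t * pk b L (n+1-j) (y + t - j * L) s)
        (b (y - n * L + (t + s)) * (∑ j ∈ Finset.range (n+1),
          pk b L j y t * pk b L (n-j) (y + t - j * L) s) -
        b (y - (n+1) * L + (t + s)) * ∑ j ∈ Finset.range (n+1+1),
        pk b L j y t * pk b L (n+1-j) (y + t - j * L) s) s := by
      intro s
      simp_rw [Finset.sum_range_succ _ (n+1)]
      have h1 : HasDerivAt (fun s => ∑ j ∈ Finset.range (n+1),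
          pk b L j y t * pk b L (n+1-j) (y + t - j * L) s)
        (∑ j ∈ Finset.range (n+1), pk b L j y t * (b (y - n * L + (t + s)) *
           pk b L (n-j) (y + t - j * L) s - b (y - (n+1) * L + (t + s)) *
             pk b L (n+1-j) (y + t - j * L) s)) s := by
        refine HasDerivAt.fun_sum (fun j hj => ?_)
        have hj' : j ≤ n := Nat.lt_succ_iff.1 (Finset.mem_range.1 hj)
        have e : n + 1 - j = (n - j) + 1 := by omega
        rw [e]
        refine HasDerivAt.congr_deriv ((pk_succ_hasDerivAt (L := L) hb (n - j)
          (y + t - j * L) s).const_mul (pk b L j y t)) ?_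
        have e1 : y + t - j * L - ((n - j : ℕ) : ℝ) * L + s = y - n * L + (t + s) := by
          push_cast [hj']; ring
        have e2 : y + t - j * L - (((n - j : ℕ) : ℝ) + 1) * L + s = y - (n + 1) * L + (t + s) := by
          push_cast [hj']; ring
        rw [e1, e2]
      have h2 := (pk_zero_hasDerivAt (L := L) hb (y + t - ((n+1 : ℕ) : ℝ) * L) s).const_mul
          (pk b L (n+1) y t)
      simp only [Nat.sub_self]
      refine HasDerivAt.congr_deriv (h1.add h2) ?_
      simp only [mul_sub, mul_add, Finset.sum_sub_distrib, Finset.mul_sum]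
      have e2 : y + t - ((n+1 : ℕ) : ℝ) * L + s = y - (n+1) * L + (t + s) := by push_cast; ring
      rw [e2]
      have e3 : ∀ (c : ℝ) (F : ℕ → ℝ), ∑ j ∈ Finset.range (n+1), c * (pk b L j y t * F j)
        = ∑ j ∈ Finset.range (n+1), pk b L j y t * (c * F j) := by
        intro c F; refine Finset.sum_congr rfl (fun j _ => by ring)
      rw [e3, e3]
      ring
    have := ode_unique hb (y - (n+1) * L + t) (E := fun s => pk b L (n+1) y (t + s) -
        ∑ j ∈ Finset.range (n+1+1), pk b L j y t * pk b L (n+1-j) (y + t - j * L) s) (E' := _)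
      (fun s _ => ((pk_succ_hasDerivAt hb n y (t + s)).comp_const_add t s).sub (key s))
      (fun s hs => by rw [← ih s hs, ← add_assoc]; ring) ?_ s hs
    · linarith
    · rw [Finset.sum_range_succ]
      simp only [add_zero, Nat.sub_self, pk_zero_zero, mul_one]
      rw [Finset.sum_eq_zero]
      · simp
      · intro j hj
        have hj' : j ≤ n := Nat.lt_succ_iff.1 (Finset.mem_range.1 hj)
        have e : n + 1 - j = (n - j) + 1 := by omega
        rw [e, pk_succ_zero, mul_zero]

end Mit

namespace Mit

variable {b : ℝ → ℝ} {L : ℝ}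

/-- transition kernel on the lattice, indexed by `ℤ` -/
def Kz (b : ℝ → ℝ) (L t y : ℝ) (n : ℤ) : ℝ := if n ≤ 0 then pk b L n.natAbs y t else 0

lemma Kz_neg (t y : ℝ) (k : ℕ) : Kz b L t y (-(k : ℤ)) = pk b L k y t := by
  simp [Kz]

lemma Kz_pos (t y : ℝ) (n : ℤ) (hn : 0 < n) : Kz b L t y n = 0 := by
  simp [Kz, not_le.2 hn]

lemma Kz_nonneg (hb : Continuous b) (hb0 : ∀ y, 0 ≤ b y) (t y : ℝ) (ht : 0 ≤ t) (n : ℤ) :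
    0 ≤ Kz b L t y n := by
  unfold Kz; split_ifs
  · exact pk_nonneg hb hb0 _ y t ht
  · exact le_rfl

lemma neg_inj : Function.Injective (fun k : ℕ => -(k : ℤ)) := fun a b h => by simpa using h

lemma not_range_neg {n : ℤ} (hn : n ∉ range (fun k : ℕ => -(k : ℤ))) : 0 < n := by
  by_contra h
  exact hn ⟨n.natAbs, by simp only; omega⟩

lemma Kz_hasSum (hb : Continuous b) (hb0 : ∀ y, 0 ≤ b y) (hbb : ∀ r, ∃ C, ∀ y ≤ r, b y ≤ C)
    (hL : 0 ≤ L) (t y : ℝ) (ht : 0 ≤ t) : HasSum (Kz b L t y) 1 := by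
  rw [← neg_inj.hasSum_iff (fun n hn => Kz_pos t y n (not_range_neg hn))]
  have : (Kz b L t y ∘ fun k : ℕ => -(k : ℤ)) = fun k => pk b L k y t := by
    funext k; exact Kz_neg t y k
  rw [this]
  exact pk_hasSum hb hb0 hbb hL y t ht

lemma Kz_CK (hb : Continuous b) (t s y : ℝ) (hs : 0 ≤ s) (n : ℤ) :
    Kz b L (t + s) y n = ∑' j : ℤ, Kz b L t y j * Kz b L s (y + t + j * L) (n - j) := by
  rw [← neg_inj.tsum_eq]
  swap
  · intro j hj
    by_contra h
    exact hj (by simp [Kz_pos t y j (not_range_neg h)])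
  simp only [Kz_neg]
  rcases lt_or_ge 0 n with hn | hn
  · rw [Kz_pos _ _ _ hn]
    symm
    convert tsum_zero with i
    rw [Kz_pos _ _ (n - -(i : ℤ)) (by omega), mul_zero]
  · obtain ⟨m, rfl⟩ : ∃ m : ℕ, n = -(m : ℤ) := ⟨n.natAbs, by omega⟩
    rw [Kz_neg, tsum_eq_sum (s := Finset.range (m+1)), pk_CK hb y t m s hs]
    · refine Finset.sum_congr rfl (fun j hj => ?_)
      have hj' : j ≤ m := Nat.lt_succ_iff.1 (Finset.mem_range.1 hj)
      have e : -(m : ℤ) - -(j : ℤ) = -((m - j : ℕ) : ℤ) := by omega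
      rw [e, Kz_neg]
      congr 2
      push_cast; ring
    · intro i hi
      have hi' : m < i := by simpa using hi
      rw [Kz_pos _ _ (-(m : ℤ) - -(i : ℤ)) (by omega), mul_zero]

lemma swap_summable {a : ℤ → ℝ} {K : ℤ → ℤ → ℝ} {g : ℤ → ℝ} {C : ℝ} (ha : ∀ j, 0 ≤ a j)
    (has : Summable a) (hK : ∀ j k, 0 ≤ K j k) (hKs : ∀ j, HasSum (K j) 1) (hg : ∀ n, |g n| ≤ C) :
    Summable (fun p : ℤ × ℤ => a p.1 * K p.1 p.2 * g (p.1 + p.2)) := by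
  have h1 : Summable (fun p : ℤ × ℤ => a p.1 * K p.1 p.2) := by
    have h0 : 0 ≤ (fun p : ℤ × ℤ => a p.1 * K p.1 p.2) := fun p => mul_nonneg (ha p.1) (hK p.1 p.2)
    rw [summable_prod_of_nonneg h0]
    refine ⟨fun j => Summable.mul_left (a j) (hKs j).summable, ?_⟩
    have e : (fun j => ∑' k, a j * K j k) = a := by
      funext j
      rw [tsum_mul_left, (hKs j).tsum_eq, mul_one]
    show Summable (fun j => ∑' k, a j * K j k)
    rw [e]; exact has
  refine Summable.of_norm_bounded (h1.mul_right C) (fun p => ?_)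
  rw [norm_mul, Real.norm_of_nonneg (mul_nonneg (ha _) (hK _ _))]
  exact mul_le_mul_of_nonneg_left (hg _) (mul_nonneg (ha _) (hK _ _))

lemma swap_tsum {a : ℤ → ℝ} {K : ℤ → ℤ → ℝ} {g : ℤ → ℝ} {C : ℝ} (ha : ∀ j, 0 ≤ a j)
    (has : Summable a) (hK : ∀ j k, 0 ≤ K j k) (hKs : ∀ j, HasSum (K j) 1) (hg : ∀ n, |g n| ≤ C) :
    ∑' j, a j * (∑' k, K j k * g (j + k)) = ∑' n, (∑' j, a j * K j (n - j)) * g n := by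
  have hs := swap_summable ha has hK hKs hg
  have e1 : ∀ j, a j * (∑' k, K j k * g (j + k)) = ∑' n, a j * K j (n - j) * g n := by
    intro j
    rw [← tsum_mul_left, ← (Equiv.addRight (-j)).tsum_eq]
    refine tsum_congr (fun n => ?_)
    simp only [Equiv.coe_addRight]
    rw [← sub_eq_add_neg, add_sub_cancel, mul_assoc]
  simp_rw [e1]
  have hs2 : Summable (Function.uncurry fun j n => a j * K j (n - j) * g n) := by
    let e : ℤ × ℤ ≃ ℤ × ℤ :=
      { toFun := fun p => (p.1, p.2 - p.1)
        invFun := fun p => (p.1, p.2 + p.1)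
        left_inv := fun p => by simp
        right_inv := fun p => by simp }
    have := e.summable_iff.2 hs
    convert this using 1
    funext p
    simp [Function.uncurry, e]
  rw [← hs2.tsum_comm]
  refine tsum_congr (fun n => ?_)
  rw [tsum_mul_right]

lemma summable_mul_bdd {a g : ℤ → ℝ} {C : ℝ} (ha : ∀ j, 0 ≤ a j) (has : Summable a)
    (hg : ∀ n, |g n| ≤ C) : Summable (fun n => a n * g n) := by
  refine Summable.of_norm_bounded (has.mul_right C) (fun p => ?_)
  rw [norm_mul, Real.norm_of_nonneg (ha _)]
  exact mul_le_mul_of_nonneg_left (hg _) (ha _)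

lemma tsum_mul_bdd {a g : ℤ → ℝ} {C : ℝ} (ha : ∀ j, 0 ≤ a j) (has : HasSum a 1)
    (hg : ∀ n, |g n| ≤ C) : |∑' n, a n * g n| ≤ C := by
  have h := tsum_of_norm_bounded (f := fun n => a n * g n) (has.mul_right C) (fun p => by
    rw [norm_mul, Real.norm_of_nonneg (ha _)]
    exact mul_le_mul_of_nonneg_left (hg _) (ha _))
  simpa using h

/-- Markov semigroup in logarithmic variable -/
def Pt (b : ℝ → ℝ) (L t : ℝ) (g : ℝ → ℝ) (y : ℝ) : ℝ := ∑' n : ℤ, Kz b L t y n * g (y + t + n * L)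

/-- invariant average -/
def Av (W : ℝ → ℝ) (L : ℝ) (g : ℝ → ℝ) (y : ℝ) : ℝ := ∑' n : ℤ, W (y + n * L) * g (y + n * L)

structure HypB (b : ℝ → ℝ) (L : ℝ) : Prop where
  hb : Continuous b
  hb0 : ∀ y, 0 ≤ b y
  hbb : ∀ r, ∃ C, ∀ y ≤ r, b y ≤ C
  hL : 0 < L

structure HypW (b : ℝ → ℝ) (L : ℝ) (W : ℝ → ℝ) : Prop extends HypB b L where
  hW0 : ∀ y, 0 ≤ W y
  hWd : ∀ y, HasDerivAt W (b (y + L) * W (y + L) - b y * W y) y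
  hWs : ∀ y, HasSum (fun n : ℤ => W (y + n * L)) 1

variable {W : ℝ → ℝ}

lemma Pt_bdd (h : HypB b L) {t : ℝ} (ht : 0 ≤ t) {g : ℝ → ℝ} {C : ℝ} (hg : ∀ z, |g z| ≤ C) (y : ℝ) :
    |Pt b L t g y| ≤ C :=
  tsum_mul_bdd (fun _ => Kz_nonneg h.hb h.hb0 _ _ ht _) (Kz_hasSum h.hb h.hb0 h.hbb h.hL.le _ _ ht)
    (fun _ => hg _)

lemma Pt_add (h : HypB b L) {t s : ℝ} (ht : 0 ≤ t) (hs : 0 ≤ s) {g : ℝ → ℝ} {C : ℝ}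
    (hg : ∀ z, |g z| ≤ C) (y : ℝ) : Pt b L (t + s) g y = Pt b L t (Pt b L s g) y := by
  have := swap_tsum (a := Kz b L t y) (K := fun j => Kz b L s (y + t + j * L))
    (g := fun n => g (y + (t + s) + n * L)) (C := C) (fun _ => Kz_nonneg h.hb h.hb0 _ _ ht _)
    (Kz_hasSum h.hb h.hb0 h.hbb h.hL.le _ _ ht).summable (fun _ _ => Kz_nonneg h.hb h.hb0 _ _ hs _)
    (fun j => Kz_hasSum h.hb h.hb0 h.hbb h.hL.le _ _ hs) (fun _ => hg _)
  unfold Pt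
  simp_rw [Kz_CK h.hb t s y hs]
  rw [← this]
  refine tsum_congr (fun j => ?_)
  congr 1
  refine tsum_congr (fun k => ?_)
  congr 2
  push_cast; ring

lemma dom (h : HypW b L W) (N : ℕ) : ∀ z s, 0 ≤ s →
    ∑ k ∈ Finset.range (N+1), W (z + k * L) * pk b L k (z + k * L) s ≤ W (z + s) := by
  induction N with
  | zero =>
    intro z s hs
    have := ode_nonneg h.hb z (E := fun s => W (z + s) - W z * pk b L 0 z s)
      (fun s _ => ((h.hWd (z + s)).comp_const_add z s).sub ((pk_zero_hasDerivAt h.hb z s).const_mul _))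
      (fun s _ => by
        have := mul_nonneg (h.hb0 (z + s + L)) (h.hW0 (z + s + L))
        linarith) (by simp [pk_zero_zero]) s hs
    simpa using this
  | succ N ih =>
    intro z s hs
    have key : ∀ s, HasDerivAt (fun s => ∑ k ∈ Finset.range (N+1+1), W (z + k * L) * pk b L k (z + k * L) s)
        (b (z + s + L) * (∑ k ∈ Finset.range (N+1), W (z + L + k * L) * pk b L k (z + L + k * L) s)
          - b (z + s) * ∑ k ∈ Finset.range (N+1+1), W (z + k * L) * pk b L k (z + k * L) s) s := by
      intro s
      simp_rw [Finset.sum_range_succ' _ (N+1)]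
      have h1 : HasDerivAt (fun s => ∑ k ∈ Finset.range (N+1), W (z + (k + 1 : ℕ) * L) *
          pk b L (k+1) (z + (k + 1 : ℕ) * L) s)
          (∑ k ∈ Finset.range (N+1), W (z + (k + 1 : ℕ) * L) *
            (b (z + s + L) * pk b L k (z + L + k * L) s -
              b (z + s) * pk b L (k+1) (z + (k + 1 : ℕ) * L) s)) s := by
        refine HasDerivAt.fun_sum (fun k _ => ?_)
        refine HasDerivAt.congr_deriv
          ((pk_succ_hasDerivAt h.hb k (z + (k + 1 : ℕ) * L) s).const_mul _) ?_
        have e1 : z + (k + 1 : ℕ) * L - k * L + s = z + s + L := by push_cast; ring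
        have e2 : z + (k + 1 : ℕ) * L - (k + 1) * L + s = z + s := by push_cast; ring
        have e3 : z + (k + 1 : ℕ) * L = z + L + k * L := by push_cast; ring
        rw [e1, e2, e3]
      have h2 := (pk_zero_hasDerivAt (L := L) h.hb (z + (0 : ℕ) * L) s).const_mul (W (z + (0 : ℕ) * L))
      refine HasDerivAt.congr_deriv (h1.add h2) ?_
      have e3 : ∀ k : ℕ, z + (k + 1 : ℕ) * L = z + L + k * L := by intro k; push_cast; ring
      simp only [e3, mul_sub, mul_add, Finset.sum_sub_distrib, Finset.mul_sum]
      have e4 : ∀ (c : ℝ) (F G : ℕ → ℝ), ∑ j ∈ Finset.range (N+1), c * (F j * G j)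
        = ∑ j ∈ Finset.range (N+1), F j * (c * G j) := by
        intro c F G; refine Finset.sum_congr rfl (fun j _ => by ring)
      rw [e4, e4]
      simp only [Nat.cast_zero, zero_mul, add_zero]
      ring
    have := ode_nonneg h.hb z (E := fun s => W (z + s) -
        ∑ k ∈ Finset.range (N+1+1), W (z + k * L) * pk b L k (z + k * L) s) (E' := _)
      (fun s _ => ((h.hWd (z + s)).comp_const_add z s).sub (key s)) (fun s hs => by
        have h1 := ih (z + L) s hs
        have e : z + L + s = z + s + L := by ring
        rw [e] at h1
        have := mul_le_mul_of_nonneg_left h1 (h.hb0 (z + s + L))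
        linarith) ?_ s hs
    · linarith
    · rw [Finset.sum_range_succ']
      simp [pk_succ_zero, pk_zero_zero]

lemma add_inj (n : ℤ) : Function.Injective (fun k : ℕ => n + (k : ℤ)) := fun a b h => by simpa using h

lemma conv_support (s y : ℝ) (n : ℤ) (j : ℤ) (hj : j ∉ range (fun k : ℕ => n + (k : ℤ))) :
    W (y + j * L) * Kz b L s (y + j * L) (n - j) = 0 := by
  have : 0 < n - j := by
    by_contra h
    exact hj ⟨(j - n).natAbs, by simp only; omega⟩
  rw [Kz_pos _ _ _ this, mul_zero]

lemma conv_comp (s y : ℝ) (n : ℤ) :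
    ((fun j : ℤ => W (y + j * L) * Kz b L s (y + j * L) (n - j)) ∘ fun k : ℕ => n + (k : ℤ))
     = fun k : ℕ => W (y + n * L + k * L) * pk b L k (y + n * L + k * L) s := by
  funext k
  simp only [Function.comp]
  have e : n - (n + (k : ℤ)) = -(k : ℤ) := by ring
  rw [e, Kz_neg]
  have e : y + ((n + (k : ℤ) : ℤ) : ℝ) * L = y + n * L + k * L := by push_cast; ring
  rw [e]

lemma conv_le (h : HypW b L W) (s y : ℝ) (hs : 0 ≤ s) (n : ℤ) :
    Summable (fun j : ℤ => W (y + j * L) * Kz b L s (y + j * L) (n - j)) ∧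
    ∑' j : ℤ, W (y + j * L) * Kz b L s (y + j * L) (n - j) ≤ W (y + s + n * L) := by
  have h0 : ∀ k : ℕ, 0 ≤ W (y + n * L + k * L) * pk b L k (y + n * L + k * L) s :=
    fun k => mul_nonneg (h.hW0 _) (pk_nonneg h.hb h.hb0 _ _ _ hs)
  have hle : ∀ N, ∑ k ∈ Finset.range N, W (y + n * L + k * L) * pk b L k (y + n * L + k * L) s
      ≤ W (y + s + n * L) := by
    intro N
    have := dom h N (y + n * L) s hs
    rw [Finset.sum_range_succ] at this
    have e : y + n * L + s = y + s + n * L := by ring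
    rw [e] at this
    linarith [h0 N]
  constructor
  · rw [← (add_inj n).summable_iff (conv_support s y n), conv_comp]
    exact summable_of_sum_range_le h0 hle
  · rw [← (add_inj n).tsum_eq]
    · have := conv_comp (b := b) (L := L) (W := W) s y n
      calc _ = ∑' k : ℕ, W (y + n * L + k * L) * pk b L k (y + n * L + k * L) s :=
            tsum_congr (fun k => congrFun this k)
        _ ≤ _ := Real.tsum_le_of_sum_range_le h0 hle
    · intro j hj
      by_contra hh
      exact hj (conv_support s y n j hh)

lemma conv_eq (h : HypW b L W) (s y : ℝ) (hs : 0 ≤ s) (n : ℤ) :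
    ∑' j : ℤ, W (y + j * L) * Kz b L s (y + j * L) (n - j) = W (y + s + n * L) := by
  have h1 := swap_tsum (a := fun j : ℤ => W (y + j * L)) (K := fun j => Kz b L s (y + j * L))
    (g := fun n => 1) (C := 1) (fun _ => h.hW0 _) (h.hWs y).summable
    (fun _ _ => Kz_nonneg h.hb h.hb0 _ _ hs _)
    (fun j => Kz_hasSum h.hb h.hb0 h.hbb h.hL.le _ _ hs) (by simp)
  simp only [mul_one, (Kz_hasSum h.hb h.hb0 h.hbb h.hL.le _ _ hs).tsum_eq, (h.hWs y).tsum_eq] at h1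
  have hsm : Summable (fun n : ℤ => ∑' j : ℤ, W (y + j * L) * Kz b L s (y + j * L) (n - j)) := by
    refine Summable.of_nonneg_of_le (fun n => tsum_nonneg (fun j => mul_nonneg (h.hW0 _)
      (Kz_nonneg h.hb h.hb0 _ _ hs _))) (fun n => (conv_le h s y hs n).2) (h.hWs (y + s)).summable
  have h2 : HasSum (fun n : ℤ => ∑' j : ℤ, W (y + j * L) * Kz b L s (y + j * L) (n - j)) 1 := by
    rw [h1]; exact hsm.hasSum
  have h3 := (h.hWs (y + s)).sub h2
  rw [sub_self, hasSum_zero_iff_of_nonneg (fun n => sub_nonneg.2 (conv_le h s y hs n).2)] at h3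
  have := congrFun h3 n
  simp only [Pi.zero_apply] at this
  linarith

lemma Av_Pt (h : HypW b L W) {s : ℝ} (hs : 0 ≤ s) {g : ℝ → ℝ} {C : ℝ} (hg : ∀ z, |g z| ≤ C) (y : ℝ) :
    Av W L (Pt b L s g) y = Av W L g (y + s) := by
  have h1 := swap_tsum (a := fun j : ℤ => W (y + j * L)) (K := fun j => Kz b L s (y + j * L))
    (g := fun n => g (y + s + n * L)) (C := C) (fun _ => h.hW0 _) (h.hWs y).summable
    (fun _ _ => Kz_nonneg h.hb h.hb0 _ _ hs _)
    (fun j => Kz_hasSum h.hb h.hb0 h.hbb h.hL.le _ _ hs) (fun _ => hg _)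
  simp_rw [conv_eq h s y hs] at h1
  unfold Av Pt
  rw [← h1]
  refine tsum_congr (fun j => ?_)
  congr 1
  refine tsum_congr (fun k => ?_)
  congr 2
  push_cast; ring

lemma Av_bdd (h : HypW b L W) {g : ℝ → ℝ} {C : ℝ} (hg : ∀ z, |g z| ≤ C) (y : ℝ) :
    |Av W L g y| ≤ C := tsum_mul_bdd (fun _ => h.hW0 _) (h.hWs y) (fun _ => hg _)

lemma Av_periodic (W : ℝ → ℝ) (L : ℝ) (g : ℝ → ℝ) (y : ℝ) : Av W L g (y + L) = Av W L g y := by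
  unfold Av
  rw [← (Equiv.addRight (1:ℤ)).tsum_eq (fun n : ℤ => W (y + n * L) * g (y + n * L))]
  refine tsum_congr (fun n => ?_)
  have e : y + L + n * L = y + ((n + 1 : ℤ) : ℝ) * L := by push_cast; ring
  simp only [Equiv.coe_addRight]
  rw [e]

lemma Av_periodic_nat (W : ℝ → ℝ) (L : ℝ) (g : ℝ → ℝ) (y : ℝ) (m : ℕ) :
    Av W L g (y + m * L) = Av W L g y := by
  induction m with
  | zero => simp
  | succ m ih =>
    rw [← ih, ← Av_periodic W L g (y + m * L)]
    congr 1; push_cast; ring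

end Mit

namespace Mit

variable {b : ℝ → ℝ} {L : ℝ} {W : ℝ → ℝ}

lemma hs_congr {ι : Type*} {f g : ι → ℝ} {a c : ℝ} (h : HasSum f a) (hf : ∀ i, f i = g i)
    (hac : a = c) : HasSum g c := by
  have : f = g := funext hf
  rw [← this, ← hac]; exact h

structure HypD (b : ℝ → ℝ) (L : ℝ) (W : ℝ → ℝ) : Prop extends HypW b L W where
  hD : ∃ Al : ℝ → Prop, (∀ z, Al z → (∃ s ∈ Icc 0 L, 0 < b (z + s)) ∧ 0 < W z) ∧
    (∀ z, ¬ Al z → ∀ s ∈ Icc 0 L, b (z + s) = 0) ∧ (∀ z, ∃ N : ℕ, Al (z + N * L))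

lemma Pt_hasSum (h : HypB b L) {t : ℝ} (ht : 0 ≤ t) {g : ℝ → ℝ} {C : ℝ} (hg : ∀ z, |g z| ≤ C) (y : ℝ) :
    HasSum (fun n : ℤ => Kz b L t y n * g (y + t + n * L)) (Pt b L t g y) :=
  (summable_mul_bdd (fun _ => Kz_nonneg h.hb h.hb0 _ _ ht _)
    (Kz_hasSum h.hb h.hb0 h.hbb h.hL.le _ _ ht).summable (fun _ => hg _)).hasSum

lemma Av_hasSum (h : HypW b L W) {g : ℝ → ℝ} {C : ℝ} (hg : ∀ z, |g z| ≤ C) (y : ℝ) :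
    HasSum (fun n : ℤ => W (y + n * L) * g (y + n * L)) (Av W L g y) :=
  (summable_mul_bdd (fun _ => h.hW0 _) (h.hWs y).summable (fun _ => hg _)).hasSum

lemma sq_bdd {g : ℝ → ℝ} {C : ℝ} (hg : ∀ z, |g z| ≤ C) (z : ℝ) : |g z ^ 2| ≤ C ^ 2 := by
  rw [abs_pow]; exact pow_le_pow_left₀ (abs_nonneg _) (hg z) 2

lemma var_le (h : HypB b L) {g : ℝ → ℝ} {C : ℝ} (hg : ∀ z, |g z| ≤ C) (y : ℝ) (n : ℤ) :
    Kz b L L y n * (g (y + L + n * L) - Pt b L L g y) ^ 2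
      ≤ Pt b L L (fun z => g z ^ 2) y - (Pt b L L g y) ^ 2 := by
  have h1 := Pt_hasSum h h.hL.le (sq_bdd hg) y
  have h2 := (Pt_hasSum h h.hL.le hg y).mul_left (2 * Pt b L L g y)
  have h3 := (Kz_hasSum h.hb h.hb0 h.hbb h.hL.le L y h.hL.le).mul_right ((Pt b L L g y) ^ 2)
  have h4 := (h1.sub h2).add h3
  have h5 : HasSum (fun n : ℤ => Kz b L L y n * (g (y + L + n * L) - Pt b L L g y) ^ 2)
      (Pt b L L (fun z => g z ^ 2) y - (Pt b L L g y) ^ 2) := by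
    exact hs_congr h4 (fun n => by ring) (by ring)
  exact le_hasSum h5 n (fun m _ => mul_nonneg (Kz_nonneg h.hb h.hb0 _ _ h.hL.le _) (sq_nonneg _))

lemma diss (h : HypW b L W) {g : ℝ → ℝ} {C : ℝ} (hg : ∀ z, |g z| ≤ C) (y : ℝ) (n : ℤ) :
    W y * (Kz b L L y n * (g (y + L + n * L) - Pt b L L g y) ^ 2)
      ≤ Av W L (fun z => g z ^ 2) y - Av W L (fun z => Pt b L L g z ^ 2) y := by
  have h1 := Av_hasSum h (g := Pt b L L (fun z => g z ^ 2)) (Pt_bdd h.toHypB h.hL.le (sq_bdd hg)) y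
  have h2 := Av_hasSum h (g := fun z => Pt b L L g z ^ 2) (sq_bdd (Pt_bdd h.toHypB h.hL.le hg)) y
  have h3 := h1.sub h2
  rw [Av_Pt h h.hL.le (sq_bdd hg), Av_periodic] at h3
  have h4 := le_hasSum h3 0 (fun m _ => by
    rw [← mul_sub]
    refine mul_nonneg (h.hW0 _) ?_
    refine le_trans ?_ (var_le h.toHypB hg _ 0)
    exact mul_nonneg (Kz_nonneg h.hb h.hb0 _ _ h.hL.le _) (sq_nonneg _))
  refine le_trans ?_ h4
  simp only [Int.cast_zero, zero_mul, add_zero]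
  rw [← mul_sub]
  exact mul_le_mul_of_nonneg_left (var_le h.toHypB hg y n) (h.hW0 y)

/-- iterates at multiples of the period -/
def vm (b : ℝ → ℝ) (L : ℝ) (g : ℝ → ℝ) (m : ℕ) : ℝ → ℝ := Pt b L (m * L) g

lemma vm_bdd (h : HypB b L) {g : ℝ → ℝ} {C : ℝ} (hg : ∀ z, |g z| ≤ C) (m : ℕ) (z : ℝ) :
    |vm b L g m z| ≤ C := Pt_bdd h (mul_nonneg (Nat.cast_nonneg m) h.hL.le) hg z

lemma vm_succ (h : HypB b L) {g : ℝ → ℝ} {C : ℝ} (hg : ∀ z, |g z| ≤ C) (m : ℕ) :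
    vm b L g (m+1) = Pt b L L (vm b L g m) := by
  funext z
  unfold vm
  rw [← Pt_add h h.hL.le (mul_nonneg (Nat.cast_nonneg m) h.hL.le) hg]
  congr 1; push_cast; ring

lemma vm_diss (h : HypW b L W) {g : ℝ → ℝ} {C : ℝ} (hg : ∀ z, |g z| ≤ C) (y : ℝ) (n : ℤ)
    (hpos : 0 < W y * Kz b L L y n) :
    Tendsto (fun m => vm b L g m (y + L + n * L) - vm b L g (m+1) y) atTop (𝓝 0) := by
  set a : ℕ → ℝ := fun m => Av W L (fun z => vm b L g m z ^ 2) y with ha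
  have hd : ∀ m, W y * Kz b L L y n * (vm b L g m (y + L + n * L) - vm b L g (m+1) y) ^ 2
      ≤ a m - a (m+1) := by
    intro m
    have := diss h (vm_bdd h.toHypB hg m) y n
    rw [← vm_succ h.toHypB hg m] at this
    rw [mul_assoc]; exact this
  have hanti : Antitone a := antitone_nat_of_succ_le (fun m => by
    have := hd m
    have h2 := mul_nonneg hpos.le (sq_nonneg (vm b L g m (y + L + n * L) - vm b L g (m+1) y))
    linarith)
  have hbelow : BddBelow (range a) := ⟨0, by
    rintro _ ⟨m, rfl⟩
    exact tsum_nonneg (fun j => mul_nonneg (h.hW0 _) (sq_nonneg _))⟩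
  have hlim := tendsto_atTop_ciInf hanti hbelow
  have hlim2 : Tendsto (fun m => a m - a (m+1)) atTop (𝓝 0) := by
    have := hlim.sub (hlim.comp (tendsto_add_atTop_nat 1))
    simpa using this
  have hlim3 : Tendsto (fun m => (vm b L g m (y + L + n * L) - vm b L g (m+1) y) ^ 2) atTop (𝓝 0) := by
    have h4 := hlim2.div_const (W y * Kz b L L y n)
    rw [zero_div] at h4
    refine squeeze_zero (fun _ => sq_nonneg _) (fun m => ?_) h4
    rw [le_div_iff₀ hpos, mul_comm]
    exact hd m
  have := hlim3.sqrt
  simp only [Real.sqrt_sq_eq_abs, Real.sqrt_zero] at this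
  exact (tendsto_zero_iff_abs_tendsto_zero _).2 this

lemma Kz_zero_pos (y t : ℝ) : 0 < Kz b L t y 0 := by
  simp only [Kz, le_refl, if_true, Int.natAbs_zero, pk]; exact exp_pos _

lemma Kz_neg_one_pos (h : HypB b L) (y : ℝ) (hs : ∃ s ∈ Icc 0 L, 0 < b (y + s)) :
    0 < Kz b L L y (-1) := by
  have e : Kz b L L y (-1) = pk b L (0+1) y L := Kz_neg L y 1
  rw [e]
  simp only [pk]
  refine mul_pos (exp_pos _) ?_
  apply intervalIntegral.integral_pos h.hL
  · refine Continuous.continuousOn ?_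
    have h1 := Acc_continuous' h.hb y
    have h2 := Acc_continuous' h.hb (y - (((0:ℕ):ℝ)+1) * L)
    have := h.hb
    fun_prop
  · intro s _
    have := h.hb0 (y - (0:ℕ) * L + s)
    positivity
  · obtain ⟨s, hs1, hs2⟩ := hs
    refine ⟨s, hs1, ?_⟩
    have : 0 < b (y - (0:ℕ) * L + s) := by simpa using hs2
    positivity

lemma Pt_dead (h : HypB b L) (y : ℝ) (hs : ∀ s ∈ Icc 0 L, b (y + s) = 0) (g : ℝ → ℝ) :
    Pt b L L g y = g (y + L) := by
  have hK0 : Kz b L L y 0 = 1 := by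
    simp only [Kz, le_refl, if_true, Int.natAbs_zero, pk]
    have : Acc b y L = 0 := by
      unfold Acc
      rw [intervalIntegral.integral_congr (g := fun _ => 0)]
      · simp
      · intro s hs'
        rw [uIcc_of_le h.hL.le] at hs'
        exact hs s hs'
    simp [this]
  have hK : ∀ n : ℤ, n ≠ 0 → Kz b L L y n = 0 := by
    intro n hn
    have h1 := Kz_hasSum h.hb h.hb0 h.hbb h.hL.le L y h.hL.le
    have h2 := sum_le_hasSum ({0, n} : Finset ℤ)
      (fun i _ => Kz_nonneg h.hb h.hb0 _ _ h.hL.le _) h1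
    rw [Finset.sum_pair hn.symm, hK0] at h2
    have h3 := Kz_nonneg (L := L) h.hb h.hb0 L y h.hL.le n
    linarith
  unfold Pt
  rw [tsum_eq_single 0 (fun n hn => by rw [hK n hn, zero_mul]), hK0]
  simp

lemma vm_tendsto (h : HypD b L W) {g : ℝ → ℝ} {C : ℝ} (hg : ∀ z, |g z| ≤ C) (y : ℝ) :
    Tendsto (fun m => vm b L g m y) atTop (𝓝 (Av W L g y)) := by
  obtain ⟨Al, hA1, hA2, hA3⟩ := h.hD
  have hW := h.toHypW
  have hB := hW.toHypB
  have step : ∀ z, Tendsto (fun m => vm b L g m (z + L) - vm b L g (m+1) z) atTop (𝓝 0) := by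
    intro z
    by_cases hz : Al z
    · have := vm_diss hW hg z 0 (mul_pos (hA1 z hz).2 (Kz_zero_pos z L))
      simpa using this
    · simp_rw [vm_succ hB hg, Pt_dead hB z (hA2 z hz), sub_self]
      exact tendsto_const_nhds
  have stay0 : ∀ (N : ℕ) z, Al (z + N * L) →
      Tendsto (fun m => vm b L g m z - vm b L g (m+1) z) atTop (𝓝 0) := by
    intro N
    have alive : ∀ z, Al z → Tendsto (fun m => vm b L g m z - vm b L g (m+1) z) atTop (𝓝 0) := by
      intro z hz
      have := vm_diss hW hg z (-1) (mul_pos (hA1 z hz).2 (Kz_neg_one_pos hB z (hA1 z hz).1))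
      simpa using this
    induction N with
    | zero => intro z hz; exact alive z (by simpa using hz)
    | succ N ih =>
      intro z hz
      by_cases hz' : Al z
      · exact alive z hz'
      · have h1 := ih (z + L) (by convert hz using 1; push_cast; ring)
        rw [← tendsto_add_atTop_iff_nat 1]
        have e : ∀ m, vm b L g (m+1) z = vm b L g m (z + L) := fun m => by
          rw [vm_succ hB hg, Pt_dead hB z (hA2 z hz')]
        simp_rw [e]
        exact h1
  have stay : ∀ z, Tendsto (fun m => vm b L g m z - vm b L g (m+1) z) atTop (𝓝 0) := fun z => by
    obtain ⟨N, hN⟩ := hA3 z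
    exact stay0 N z hN
  have nb : ∀ z, Tendsto (fun m => vm b L g m (z + L) - vm b L g m z) atTop (𝓝 0) := fun z => by
    have := (step z).sub (stay z)
    simpa using this
  have nbn : ∀ (n : ℕ) z, Tendsto (fun m => vm b L g m (z + n * L) - vm b L g m z) atTop (𝓝 0) := by
    intro n
    induction n with
    | zero => intro z; simp
    | succ n ih =>
      intro z
      have := (ih z).add (nb (z + n * L))
      rw [add_zero] at this
      refine this.congr (fun m => ?_)
      have e : z + n * L + L = z + (n + 1 : ℕ) * L := by push_cast; ring
      rw [e]; ring
  have nbz : ∀ (n : ℤ), Tendsto (fun m => vm b L g m (y + n * L) - vm b L g m y) atTop (𝓝 0) := by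
    intro n
    rcases n.eq_nat_or_neg with ⟨k, rfl | rfl⟩
    · exact_mod_cast nbn k y
    · have := (nbn k (y + (-(k:ℤ) : ℤ) * L)).neg
      rw [neg_zero] at this
      refine this.congr (fun m => ?_)
      have e : y + (-(k:ℤ) : ℤ) * L + k * L = y := by push_cast; ring
      rw [e]; ring
  have hlim : Tendsto (fun m => ∑' n : ℤ, W (y + n * L) * (vm b L g m (y + n * L) - vm b L g m y))
      atTop (𝓝 (∑' n : ℤ, 0)) := by
    refine tendsto_tsum_of_dominated_convergence (bound := fun n : ℤ => W (y + n * L) * (C + C))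
      ((h.hWs y).summable.mul_right _) (fun n => ?_) (Eventually.of_forall fun m n => ?_)
    · simpa using (nbz n).const_mul (W (y + n * L))
    · rw [norm_mul, Real.norm_of_nonneg (h.hW0 _)]
      refine mul_le_mul_of_nonneg_left ?_ (h.hW0 _)
      exact (abs_sub _ _).trans (add_le_add (vm_bdd hB hg _ _) (vm_bdd hB hg _ _))
  have e : ∀ m, ∑' n : ℤ, W (y + n * L) * (vm b L g m (y + n * L) - vm b L g m y)
      = Av W L g y - vm b L g m y := by
    intro m
    have h1 := Av_hasSum hW (vm_bdd hB hg m) y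
    have h2 := (h.hWs y).mul_right (vm b L g m y)
    have h3 := h1.sub h2
    have e : Av W L (vm b L g m) y = Av W L g y := by
      unfold vm
      rw [Av_Pt hW (mul_nonneg (Nat.cast_nonneg m) h.hL.le) hg, Av_periodic_nat]
    rw [e, one_mul] at h3
    rw [← h3.tsum_eq]
    exact tsum_congr (fun n => by ring)
  simp_rw [e, tsum_zero] at hlim
  have := hlim.const_sub (Av W L g y)
  simpa using this

lemma scheffe {a : ℕ → ℤ → ℝ} {p : ℤ → ℝ} (ha0 : ∀ m n, 0 ≤ a m n) (hp0 : ∀ n, 0 ≤ p n)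
    (ha : ∀ m, HasSum (a m) 1) (hp : HasSum p 1) (hlim : ∀ n, Tendsto (fun m => a m n) atTop (𝓝 (p n))) :
    (∀ m, Summable (fun n => |a m n - p n|)) ∧
    Tendsto (fun m => ∑' n, |a m n - p n|) atTop (𝓝 0) := by
  have h1 : Tendsto (fun m => ∑' n, max (p n - a m n) 0) atTop (𝓝 (∑' n : ℤ, 0)) := by
    refine tendsto_tsum_of_dominated_convergence hp.summable (fun n => ?_)
      (Eventually.of_forall fun m n => ?_)
    · have := ((hlim n).const_sub (p n)).max (tendsto_const_nhds (x := (0:ℝ)))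
      simpa using this
    · rw [Real.norm_of_nonneg (le_max_right _ _)]
      exact max_le (by linarith [ha0 m n]) (hp0 n)
  rw [tsum_zero] at h1
  have hs : ∀ m, HasSum (fun n => |a m n - p n|) (2 * ∑' n, max (p n - a m n) 0 + (1 - 1)) := by
    intro m
    have hs1 : Summable (fun n => max (p n - a m n) 0) :=
      Summable.of_nonneg_of_le (fun n => le_max_right _ _)
        (fun n => max_le (by linarith [ha0 m n]) (hp0 n)) hp.summable
    refine hs_congr ((hs1.hasSum.mul_left 2).add ((ha m).sub hp)) (fun n => ?_) rfl
    rcases le_total (p n) (a m n) with hh | hh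
    · rw [abs_of_nonneg (by linarith), max_eq_right (by linarith)]; ring
    · rw [abs_of_nonpos (by linarith), max_eq_left (by linarith)]; ring
  refine ⟨fun m => (hs m).summable, ?_⟩
  simp_rw [(hs _).tsum_eq]
  simpa using h1.const_mul 2

/-- Main convergence of the Markov semigroup. -/
theorem Pt_tendsto (h : HypD b L W) {g : ℝ → ℝ} {C : ℝ} (hg : ∀ z, |g z| ≤ C) (y : ℝ) :
    Tendsto (fun t => Pt b L t g y - Av W L g (y + t)) atTop (𝓝 0) := by
  have hW := h.toHypW
  have hB := hW.toHypB
  have hL := h.hL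
  have hmL : ∀ m : ℕ, 0 ≤ m * L := fun m => mul_nonneg (Nat.cast_nonneg m) hL.le
  set a : ℕ → ℤ → ℝ := fun m n => Kz b L (m * L) y (n - m) with ha
  set p : ℤ → ℝ := fun n => W (y + n * L) with hp
  have e0 : ∀ (m : ℕ) (F : ℝ → ℝ), Pt b L (m * L) F y = ∑' n, a m n * F (y + n * L) := by
    intro m F
    unfold Pt
    rw [← (Equiv.addRight (-(m:ℤ))).tsum_eq]
    refine tsum_congr (fun n => ?_)
    simp only [Equiv.coe_addRight, ha, ← sub_eq_add_neg]
    congr 2; push_cast; ring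
  have ha1 : ∀ m, HasSum (a m) 1 := fun m => by
    rw [← (Equiv.addRight (m:ℤ)).hasSum_iff]
    convert Kz_hasSum (L := L) h.hb h.hb0 h.hbb hL.le (m * L) y (hmL m) using 1
    funext n; simp [ha]
  have hlim : ∀ n, Tendsto (fun m => a m n) atTop (𝓝 (p n)) := by
    intro n
    have inj : ∀ k : ℤ, k ≠ n → y + k * L ≠ y + n * L := by
      intro k hk heq
      have := mul_right_cancel₀ hL.ne' (add_left_cancel heq)
      exact hk (by exact_mod_cast this)
    have := vm_tendsto h (g := fun z => if z = y + n * L then 1 else 0) (C := 1)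
      (fun z => by split_ifs <;> simp) y
    unfold vm Av at this
    simp_rw [e0] at this
    have e : ∀ c : ℤ → ℝ, ∑' k : ℤ, c k * (if y + k * L = y + n * L then 1 else 0) = c n := by
      intro c
      rw [tsum_eq_single n (fun k hk => by rw [if_neg (inj k hk), mul_zero])]
      simp
    simp_rw [e] at this
    exact this
  obtain ⟨hsum, hsch⟩ := scheffe (fun m n => Kz_nonneg h.hb h.hb0 _ _ (hmL m) _)
    (fun n => h.hW0 _) ha1 (h.hWs y) hlim
  have key : ∀ t, 0 ≤ t → |Pt b L t g y - Av W L g (y + t)|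
      ≤ C * ∑' n, |a ⌊t / L⌋₊ n - p n| := by
    intro t ht
    set m := ⌊t / L⌋₊ with hm
    set s := t - m * L with hs
    have hs0 : 0 ≤ s := by
      have := Nat.floor_le (div_nonneg ht hL.le)
      rw [← hm, le_div_iff₀ hL] at this
      linarith
    have e1 : Pt b L t g y = Pt b L (m * L) (Pt b L s g) y := by
      rw [← Pt_add hB (hmL m) hs0 hg]; congr 1; rw [hs]; ring
    have e2 : Av W L g (y + t) = Av W L (Pt b L s g) y := by
      rw [Av_Pt hW hs0 hg, ← Av_periodic_nat W L g (y + s) m]; congr 1; rw [hs]; ring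
    have hb' := Pt_bdd hB hs0 hg
    have h1 := Pt_hasSum hB (hmL m) hb' y
    have h1' : HasSum (fun n : ℤ => a m n * Pt b L s g (y + n * L)) (Pt b L (m * L) (Pt b L s g) y) := by
      rw [e0]
      exact (summable_mul_bdd (fun n => Kz_nonneg h.hb h.hb0 _ _ (hmL m) _) (ha1 m).summable
        (fun _ => hb' _)).hasSum
    have h2 := h1'.sub (Av_hasSum hW hb' y)
    rw [e1, e2, ← h2.tsum_eq, mul_comm]
    refine tsum_of_norm_bounded (f := fun n : ℤ => a m n * Pt b L s g (y + n * L) -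
      W (y + n * L) * Pt b L s g (y + n * L)) ((hsum m).hasSum.mul_right C) (fun n => ?_)
    rw [← sub_mul, norm_mul]
    exact mul_le_mul_of_nonneg_left (hb' _) (abs_nonneg _)
  have hfl : Tendsto (fun t : ℝ => ⌊t / L⌋₊) atTop atTop :=
    tendsto_nat_floor_atTop.comp (tendsto_id.atTop_div_const hL)
  have h3 := (hsch.comp hfl).const_mul C
  rw [mul_zero] at h3
  rw [tendsto_zero_iff_abs_tendsto_zero]
  refine squeeze_zero' (Eventually.of_forall fun _ => abs_nonneg _) ?_ h3
  filter_upwards [eventually_ge_atTop 0] with t ht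
  exact key t ht

end Mit

namespace Mit

lemma measurable_primitive (G : ℝ → ℝ) :
    ∃ H : ℝ → ℝ, Measurable H ∧ ∀ t, 0 ≤ t → H t = ∫ s in (0:ℝ)..t, G s := by
  classical
  set J : Set ℝ := {t | 0 ≤ t ∧ IntervalIntegrable G volume 0 t} with hJ
  have hsub : ∀ t ∈ J, ∀ s, 0 ≤ s → s ≤ t → s ∈ J := by
    intro t ht s hs hst
    refine ⟨hs, ht.2.mono_set ?_⟩
    rw [uIcc_of_le hs, uIcc_of_le ht.1]
    exact Icc_subset_Icc_right hst
  have hJm : MeasurableSet J := by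
    apply OrdConnected.measurableSet
    rw [ordConnected_iff]
    intro x hx z hz _ w hw
    exact hsub z hz w (hx.1.trans hw.1) hw.2
  have hcont : ContinuousOn (fun t => ∫ s in (0:ℝ)..t, G s) J := by
    intro t ht
    by_cases hmax : ∃ t' ∈ J, t < t'
    · obtain ⟨t', ht', htt'⟩ := hmax
      have h1 := intervalIntegral.continuousOn_primitive_interval' ht'.2 left_mem_uIcc
      rw [uIcc_of_le ht'.1] at h1
      have h2 := h1 t ⟨ht.1, htt'.le⟩
      refine h2.mono_of_mem_nhdsWithin ?_
      rw [mem_nhdsWithin]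
      exact ⟨Iio t', isOpen_Iio, htt', fun s hs => ⟨hs.2.1, le_of_lt hs.1⟩⟩
    · push Not at hmax
      have h1 := intervalIntegral.continuousOn_primitive_interval' ht.2 left_mem_uIcc
      rw [uIcc_of_le ht.1] at h1
      exact (h1 t ⟨ht.1, le_rfl⟩).mono (fun s hs => ⟨hs.1, hmax s hs⟩)
  refine ⟨J.piecewise (fun t => ∫ s in (0:ℝ)..t, G s) (fun _ => 0),
    hcont.measurable_piecewise continuousOn_const hJm, fun t ht => ?_⟩
  by_cases htJ : t ∈ J
  · rw [piecewise_eq_of_mem _ _ _ htJ]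
  · rw [piecewise_eq_of_notMem _ _ _ htJ, intervalIntegral.integral_undef]
    exact fun hh => htJ ⟨ht, hh⟩

/-- backward cumulative rate -/
def Bcc (b : ℝ → ℝ) (c t : ℝ) : ℝ := ∫ u in (0:ℝ)..t, b (c - u)

lemma Bcc_hasDerivAt {b : ℝ → ℝ} (hb : Continuous b) (c t : ℝ) :
    HasDerivAt (Bcc b c) (b (c - t)) t := by
  have hc : Continuous (fun s => b (c - s)) := by fun_prop
  exact intervalIntegral.integral_hasDerivAt_right (hc.intervalIntegrable _ _)
    (hc.stronglyMeasurableAtFilter _ _) hc.continuousAt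

lemma Bcc_continuous {b : ℝ → ℝ} (hb : Continuous b) (c : ℝ) : Continuous (Bcc b c) :=
  continuous_iff_continuousAt.2 fun t => (Bcc_hasDerivAt hb c t).continuousAt

lemma mild_psi {B f : ℝ → ℝ} {φ : ℝ → ℝ → ℝ} (hb : Continuous (fun y => B (exp y)))
    (hm : IsMildSol B f φ) (c t : ℝ) (ht : 0 ≤ t) :
    φ t (exp (c - t)) = exp (-Bcc (fun y => B (exp y)) c t) * (f (exp c) +
      2 * ∫ σ in (0:ℝ)..t, B (exp (c - σ)) * exp (Bcc (fun y => B (exp y)) c σ) *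
        φ (max σ 0) (exp (c - Real.log 2 - max σ 0))) := by
  rw [hm t ht _ (exp_pos _)]
  have e1 : ∀ s, exp (c - t) * exp s = exp (c - (t - s)) := fun s => by
    rw [← exp_add]; congr 1; ring
  have e2 : ∀ σ, ∫ s in (0:ℝ)..(t - σ), B (exp (c - t) * exp s)
      = Bcc (fun y => B (exp y)) c t - Bcc (fun y => B (exp y)) c σ := by
    intro σ
    simp_rw [e1]
    rw [intervalIntegral.integral_comp_sub_left (fun u => B (exp (c - u))) t]
    unfold Bcc
    have hc : Continuous (fun u => B (exp (c - u))) :=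
      hb.comp (by fun_prop : Continuous fun u : ℝ => c - u)
    rw [intervalIntegral.integral_interval_sub_left (hc.intervalIntegrable _ _)
      (hc.intervalIntegrable _ _)]
    simp
  have e3 := e2 0
  simp only [sub_zero] at e3
  rw [e3]
  have esub := intervalIntegral.integral_comp_sub_left (a := 0) (b := t)
    (fun τ => B (exp (c - t) * exp τ) *
    exp (-∫ s in (0:ℝ)..τ, B (exp (c - t) * exp s)) * φ (t - τ) (exp (c - t) * exp τ / 2)) t
  rw [sub_self, sub_zero] at esub
  rw [← esub]
  rw [mul_add]
  have e4 : Bcc (fun y => B (exp y)) c 0 = 0 := by simp [Bcc]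
  congr 1
  · rw [e4, e1, sub_self, sub_zero, sub_zero, mul_comm]
  · rw [mul_left_comm, ← intervalIntegral.integral_const_mul (exp _)]
    congr 1
    refine intervalIntegral.integral_congr (fun σ hσ => ?_)
    rw [uIcc_of_le ht] at hσ
    have e5 : exp (c - σ) / 2 = exp (c - Real.log 2 - σ) := by
      have : c - Real.log 2 - σ = (c - σ) - Real.log 2 := by ring
      rw [this, exp_sub _ (Real.log 2), exp_log (by norm_num)]
    rw [e2 σ, max_eq_left hσ.1, e1, sub_sub_cancel, e5, neg_sub, exp_sub (Bcc _ c σ), exp_neg]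
    ring

lemma psi_bdd {φ : ℝ → ℝ → ℝ} (hl : LocBdd2 φ) (c T : ℝ) :
    ∃ C, 0 ≤ C ∧ ∀ c' ≤ c, ∀ t, 0 ≤ t → t ≤ T → |φ t (exp (c' - t))| ≤ C := by
  obtain ⟨C, hC⟩ := hl (max T (exp c)) (lt_of_lt_of_le (exp_pos c) (le_max_right _ _))
  refine ⟨max C 0, le_max_right _ _, fun c' hc' t ht htT => le_trans ?_ (le_max_left C 0)⟩
  exact hC t _ ht (htT.trans (le_max_left _ _)) (exp_pos _)
    ((exp_le_exp.2 (by linarith)).trans (le_max_right _ _))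

lemma psi_rep {B f : ℝ → ℝ} {φ : ℝ → ℝ → ℝ} (hb : Continuous (fun y => B (exp y)))
    (hl : LocBdd2 φ) (hm : IsMildSol B f φ) :
    ∃ Ψ : ℝ → ℝ → ℝ, (∀ c t, 0 ≤ t → Ψ c t = φ t (exp (c - t))) ∧
      (∀ c t, 0 ≤ t → HasDerivAt (Ψ c) (-(B (exp (c - t))) * Ψ c t
        + 2 * B (exp (c - t)) * Ψ (c - Real.log 2) t) t) := by
  set b : ℝ → ℝ := fun y => B (exp y) with hbdef
  set G : ℝ → ℝ → ℝ := fun c σ => B (exp (c - σ)) * exp (Bcc b c σ) *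
        φ (max σ 0) (exp (c - Real.log 2 - max σ 0)) with hG
  set Ψ : ℝ → ℝ → ℝ := fun c t => exp (-Bcc b c t) * (f (exp c) + 2 * ∫ σ in (0:ℝ)..t, G c σ) with hΨ
  have h1 : ∀ c t, 0 ≤ t → Ψ c t = φ t (exp (c - t)) := fun c t ht => (mild_psi hb hm c t ht).symm
  have hbc : ∀ c, Continuous (fun σ => B (exp (c - σ))) := fun c =>
    hb.comp (by fun_prop : Continuous fun u : ℝ => c - u)
  have hmeas : ∀ c, Measurable (fun σ => φ (max σ 0) (exp (c - max σ 0))) := by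
    intro c
    obtain ⟨H, hH, hH'⟩ := measurable_primitive (G c)
    have : (fun σ => φ (max σ 0) (exp (c - max σ 0)))
       = fun σ => exp (-Bcc b c (max σ 0)) * (f (exp c) + 2 * H (max σ 0)) := by
      funext σ
      rw [← h1 c _ (le_max_right _ _), hH' _ (le_max_right _ _)]
    rw [this]
    have h2 : Measurable (Bcc b c) := (Bcc_continuous hb c).measurable
    fun_prop
  have hGi : ∀ c t, IntervalIntegrable (G c) volume 0 t := by
    intro c t
    have hGm : Measurable (G c) := by
      have h2 : Measurable (Bcc b c) := (Bcc_continuous hb c).measurable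
      have h3 := hmeas (c - Real.log 2)
      have h4 := (hbc c).measurable
      simp only [hG]
      exact (h4.mul h2.exp).mul h3
    obtain ⟨C, hC0, hC⟩ := psi_bdd hl (c - Real.log 2) (max t 0)
    have hcc : Continuous fun σ => B (exp (c - σ)) * exp (Bcc b c σ) :=
      (hbc c).mul (Bcc_continuous hb c).rexp
    rw [intervalIntegrable_iff]
    have hi : IntegrableOn (fun σ => |B (exp (c - σ)) * exp (Bcc b c σ)| * C) (uIoc 0 t) :=
      intervalIntegrable_iff.1 ((hcc.abs.mul continuous_const).intervalIntegrable 0 t)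
    refine Integrable.mono' hi hGm.aestronglyMeasurable ?_
    rw [ae_restrict_iff' measurableSet_uIoc]
    refine Eventually.of_forall (fun σ hσ => ?_)
    simp only [hG]
    rw [norm_mul]
    refine mul_le_mul_of_nonneg_left ?_ (norm_nonneg _)
    refine hC _ le_rfl _ (le_max_right _ _) ?_
    rcases le_total 0 t with h | h
    · rw [uIoc_of_le h] at hσ; exact max_le_max_right _ hσ.2
    · rw [uIoc_of_ge h] at hσ
      rw [max_eq_right hσ.2]; exact le_max_right _ _
  have hΨc : ∀ c, Continuous (Ψ c) := by
    intro c
    have h2 : Continuous fun t => ∫ σ in (0:ℝ)..t, G c σ :=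
      intervalIntegral.continuous_primitive (fun x y =>
        (hGi c x).symm.trans (hGi c y)) 0
    have h3 := Bcc_continuous hb c
    simp only [hΨ]
    fun_prop
  have hGc : ∀ c, Continuous (G c) := by
    intro c
    have h3 : Continuous fun σ => φ (max σ 0) (exp (c - Real.log 2 - max σ 0)) := by
      have : (fun σ => φ (max σ 0) (exp (c - Real.log 2 - max σ 0)))
        = fun σ => Ψ (c - Real.log 2) (max σ 0) := by
        funext σ; rw [h1 _ _ (le_max_right _ _)]
      rw [this]
      exact (hΨc _).comp (by fun_prop)
    exact ((hbc c).mul (Bcc_continuous hb c).rexp).mul h3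
  refine ⟨Ψ, h1, fun c t ht => ?_⟩
  have h4 := intervalIntegral.integral_hasDerivAt_right ((hGc c).intervalIntegrable 0 t)
    ((hGc c).stronglyMeasurableAtFilter _ _) (hGc c).continuousAt
  have h5 := (Bcc_hasDerivAt hb c t).neg.exp.mul ((h4.const_mul 2).const_add (f (exp c)))
  refine HasDerivAt.congr_deriv h5 ?_
  have h6 : exp (-Bcc b c t) * exp (Bcc b c t) = 1 := by rw [← exp_add]; simp
  simp only [hΨ, Pi.neg_apply]
  have h7 : G c t = B (exp (c - t)) * exp (Bcc b c t) * Ψ (c - Real.log 2) t := by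
    rw [h1 _ _ ht]; simp only [hG, max_eq_left ht]
  have h8 : Ψ (c - Real.log 2) t = exp (-Bcc b (c - Real.log 2) t) *
    (f (exp (c - Real.log 2)) + 2 * ∫ σ in (0:ℝ)..t, G (c - Real.log 2) σ) := rfl
  rw [← h8, h7]
  simp only [hbdef]
  linear_combination (2 * B (exp (c - t)) * Ψ (c - Real.log 2) t) * h6

lemma dual_rep {B f : ℝ → ℝ} {φ : ℝ → ℝ → ℝ} (h : HypB (fun y => B (exp y)) (Real.log 2))
    (hl : LocBdd2 φ) (hm : IsMildSol B f φ) (y T : ℝ) (hT : 0 ≤ T) :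
    Tendsto (fun K : ℕ => ∑ k ∈ Finset.range (K+1), 2 ^ k *
      (pk (fun y => B (exp y)) (Real.log 2) k y T * f (exp (y + T - k * Real.log 2)))) atTop
      (𝓝 (φ T (exp y))) := by
  obtain ⟨Ψ, h1, h2⟩ := psi_rep h.hb hl hm
  set b : ℝ → ℝ := fun y => B (exp y) with hbdef
  set L := Real.log 2 with hL
  have hd : ∀ (K : ℕ) s, s ∈ Icc 0 T → HasDerivAt (fun s => ∑ k ∈ Finset.range (K+1), 2 ^ k *
      (pk b L k y s * Ψ (y + T - k * L) (T - s)))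
      (-(2 ^ (K+1) * (b (y - K * L + s) * pk b L K y s * Ψ (y + T - (K+1 : ℕ) * L) (T - s)))) s := by
    intro K s hs
    have hΨ : ∀ k : ℕ, HasDerivAt (fun s => Ψ (y + T - k * L) (T - s))
        (b (y - k * L + s) * Ψ (y + T - k * L) (T - s) -
          2 * b (y - k * L + s) * Ψ (y + T - (k + 1 : ℕ) * L) (T - s)) s := by
      intro k
      refine HasDerivAt.congr_deriv ((h2 (y + T - k * L) (T - s) (by linarith [hs.2])).comp_const_sub T s) ?_
      have e1 : y + T - k * L - (T - s) = y - k * L + s := by ring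
      have e2 : y + T - k * L - L = y + T - (k + 1 : ℕ) * L := by push_cast; ring
      rw [e1, e2]
      simp only [hbdef]; ring
    induction K with
    | zero =>
      have := (pk_zero_hasDerivAt (L := L) h.hb y s).mul (hΨ 0)
      simp only [zero_add, Finset.range_one, Finset.sum_singleton, pow_zero, one_mul]
      refine HasDerivAt.congr_deriv this ?_
      simp; ring
    | succ K ih =>
      simp_rw [Finset.sum_range_succ _ (K+1)]
      refine HasDerivAt.congr_deriv (ih.add (((pk_succ_hasDerivAt (L := L) h.hb K y s).mul
        (hΨ (K+1))).const_mul (2 ^ (K+1)))) ?_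
      push_cast
      ring
  obtain ⟨C, hC⟩ := h.hbb (y + T)
  have hC0 : 0 ≤ C := (h.hb0 _).trans (hC _ le_rfl)
  obtain ⟨C', hC'0, hC'⟩ := psi_bdd hl (y + T) T
  have hlim : Tendsto (fun K : ℕ => 2 * C * C' * T * ((2 * C * T) ^ K / K.factorial)) atTop (𝓝 0) := by
    simpa using (FloorSemiring.tendsto_pow_div_factorial_atTop (2 * C * T)).const_mul (2 * C * C' * T)
  rw [tendsto_iff_norm_sub_tendsto_zero]
  refine squeeze_zero (fun _ => norm_nonneg _) (fun K => ?_) hlim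
  have key := norm_image_sub_le_of_norm_deriv_le_segment' (a := 0) (b := T)
    (C := 2 ^ (K+1) * (C * ((C * T) ^ K / K.factorial) * C'))
    (fun s hs => (hd K s hs).hasDerivWithinAt) ?_ T ⟨hT, le_rfl⟩
  · have e0 : ∑ k ∈ Finset.range (K+1), 2 ^ k * (pk b L k y 0 * Ψ (y + T - k * L) (T - 0)) = φ T (exp y) := by
      rw [Finset.sum_range_succ']
      simp only [pk_succ_zero, pk_zero_zero, zero_mul, mul_zero, Finset.sum_const_zero, zero_add,
        pow_zero, one_mul, Nat.cast_zero, sub_zero]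
      rw [h1 _ _ hT]; congr 2; ring
    have eT : ∀ k : ℕ, Ψ (y + T - k * L) (T - T) = f (exp (y + T - k * L)) := by
      intro k
      rw [sub_self, h1 _ _ le_rfl, hm 0 le_rfl _ (exp_pos _)]
      simp
    simp only [eT, e0] at key
    refine key.trans (le_of_eq ?_)
    rw [sub_zero, pow_succ, mul_pow, mul_pow, mul_pow]
    ring
  · intro s hs
    have hkL : 0 ≤ K * L := mul_nonneg (Nat.cast_nonneg _) h.hL.le
    have hkL' : 0 ≤ (K+1 : ℕ) * L := mul_nonneg (Nat.cast_nonneg _) h.hL.le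
    have hp0 := pk_nonneg (L := L) h.hb h.hb0 K y s hs.1
    rw [norm_neg, norm_mul, norm_mul, norm_mul, Real.norm_of_nonneg (h.hb0 _),
      Real.norm_of_nonneg hp0, Real.norm_of_nonneg (by positivity : (0:ℝ) ≤ 2 ^ (K+1))]
    have hT1 : 0 ≤ C * T := mul_nonneg hC0 hT
    have b1 := hC (y - K * L + s) (by linarith [hs.2])
    have b2 : pk b L K y s ≤ (C * T) ^ K / K.factorial := by
      refine (pk_le h.hb h.hb0 h.hL.le y T C hC K s hs.1 hs.2.le).trans ?_
      have h1 : C * s ≤ C * T := mul_le_mul_of_nonneg_left hs.2.le hC0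
      have h0 : 0 ≤ C * s := mul_nonneg hC0 hs.1
      gcongr
    have b3 : ‖Ψ (y + T - (K+1 : ℕ) * L) (T - s)‖ ≤ C' := by
      rw [h1 _ _ (by linarith [hs.2])]
      exact hC' _ (by linarith) _ (by linarith [hs.2]) (by linarith [hs.1])
    gcongr

theorem M_eq_Pt {B f : ℝ → ℝ} {φ : ℝ → ℝ → ℝ} (h : HypB (fun y => B (exp y)) (Real.log 2))
    (hl : LocBdd2 φ) (hm : IsMildSol B f φ) {C : ℝ} (hf : ∀ z, |f (exp z) * exp (-z)| ≤ C)
    (y T : ℝ) (hT : 0 ≤ T) :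
    φ T (exp y) = exp T * exp y * Pt (fun y => B (exp y)) (Real.log 2) T
      (fun z => f (exp z) * exp (-z)) y := by
  refine tendsto_nhds_unique (dual_rep h hl hm y T hT) ?_
  set b : ℝ → ℝ := fun y => B (exp y) with hbdef
  set L := Real.log 2 with hL
  have h1 := Pt_hasSum h hT hf y
  rw [← neg_inj.hasSum_iff (fun n hn => by rw [Kz_pos T y n (not_range_neg hn), zero_mul])] at h1
  have h2 := ((h1.tendsto_sum_nat).comp (tendsto_add_atTop_nat 1)).const_mul (exp T * exp y)
  refine h2.congr (fun K => ?_)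
  simp only [Function.comp, Kz_neg]
  rw [Finset.mul_sum]
  refine Finset.sum_congr rfl (fun k _ => ?_)
  have e : y + T + ((-(k:ℤ) : ℤ) : ℝ) * L = y + T - k * L := by push_cast; ring
  rw [e]
  have e2 : exp T * exp y * exp (-(y + T - k * L)) = 2 ^ k := by
    rw [← exp_add, ← exp_add]
    have : T + y + -(y + T - k * L) = L * k := by ring
    rw [this, hL, ← Real.rpow_def_of_pos (by norm_num), Real.rpow_natCast]
  rw [← e2]; ring

end Mit

namespace Mit

theorem mkHypB {B : ℝ → ℝ} (hB : Bhyp B) : HypB (fun y => B (exp y)) (Real.log 2) := by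
  obtain ⟨hc, h0, ε, hε, C, hC⟩ := hB
  have hcont : Continuous (fun y => B (exp y)) :=
    hc.comp_continuous continuous_exp (fun y => exp_pos y)
  refine ⟨hcont, fun y => h0 _ (exp_pos _), fun r => ?_, Real.log_pos (by norm_num)⟩
  obtain ⟨C', hC'⟩ := (isCompact_Icc (a := Real.log ε) (b := r)).exists_bound_of_continuousOn
    hcont.continuousOn
  refine ⟨max C C', fun y hy => ?_⟩
  rcases lt_or_ge y (Real.log ε) with h | h
  · exact (hC _ (exp_pos _) ((lt_log_iff_exp_lt hε).1 h)).trans (le_max_left _ _)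
  · exact ((le_abs_self _).trans (hC' y ⟨h, hy⟩)).trans (le_max_right _ _)

/-- the invariant weight in logarithmic coordinates -/
def Wd (U : ℝ → ℝ) (y : ℝ) : ℝ := Real.log 2 * (exp (2 * y) * U (exp y))

variable {B U U' : ℝ → ℝ}

lemma log2_pos : 0 < Real.log 2 := Real.log_pos (by norm_num)

lemma exp_add_log2 (y : ℝ) : exp (y + Real.log 2) = 2 * exp y := by
  rw [exp_add, exp_log (by norm_num)]; ring

lemma Wd_nonneg (hU : Perron B U U') (y : ℝ) : 0 ≤ Wd U y :=
  mul_nonneg log2_pos.le (mul_nonneg (exp_pos _).le (hU.1 _ (exp_pos _)))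

lemma Wd_deriv (hU : Perron B U U') (y : ℝ) :
    HasDerivAt (Wd U) (B (exp (y + Real.log 2)) * Wd U (y + Real.log 2) - B (exp y) * Wd U y) y := by
  have h1 : HasDerivAt (fun y => U (exp y)) (U' (exp y) * exp y) y :=
    (hU.2.1 (exp y) (exp_pos y)).comp y (Real.hasDerivAt_exp y)
  have h2 : HasDerivAt (fun y => exp (2 * y)) (exp (2 * y) * (2 * 1)) y :=
    ((hasDerivAt_id y).const_mul 2).exp
  refine HasDerivAt.congr_deriv ((h2.mul h1).const_mul (Real.log 2)) ?_
  have h3 := hU.2.2.2.1 (exp y) (exp_pos y)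
  have e1 : exp (2 * y) = exp y ^ 2 := by rw [← exp_nat_mul]; push_cast; rfl
  have e2 : exp (2 * (y + Real.log 2)) = 4 * exp y ^ 2 := by
    have : exp (2 * (y + Real.log 2)) = exp (y + Real.log 2) ^ 2 := by
      rw [← exp_nat_mul]; push_cast; rfl
    rw [this, exp_add_log2]; ring
  unfold Wd
  rw [e2, exp_add_log2, e1]
  linear_combination (Real.log 2 * exp y ^ 2) * h3

lemma Wd_exp_bdd (hU : Perron B U U') (r : ℝ) : ∃ C, ∀ y, exp (r * y) * Wd U y ≤ C := by
  obtain ⟨⟨C, hC⟩, -⟩ := hU.2.2.2.2.2 (r + 2)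
  refine ⟨Real.log 2 * C, fun y => ?_⟩
  have h := mul_le_mul_of_nonneg_left (hC (exp y) (exp_pos y)) log2_pos.le
  refine le_trans (le_of_eq ?_) h
  rw [← exp_mul, Wd, mul_left_comm, ← mul_assoc (exp _) (exp _), ← exp_add]
  congr 3; ring_nf

lemma bWd_exp_bdd (hB : Bhyp B) (hB2 : HypA2 B) (hU : Perron B U U') (r : ℝ) :
    ∃ C, ∀ y, exp (r * y) * (B (exp y) * Wd U y) ≤ C := by
  obtain ⟨-, -, -, b₁, hb₁, γ₁, -, γ₂, hγ₂, K₁, -, K₂, hK₂, hK⟩ := hB2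
  obtain ⟨C₁, hC₁⟩ := (mkHypB hB).hbb (Real.log b₁)
  obtain ⟨D₁, hD₁⟩ := Wd_exp_bdd hU r
  obtain ⟨D₂, hD₂⟩ := Wd_exp_bdd hU (r + γ₂)
  refine ⟨max C₁ 0 * D₁ + K₂ * D₂, fun y => ?_⟩
  have hW := Wd_nonneg hU y
  have hb : B (exp y) ≤ max C₁ 0 + K₂ * exp (γ₂ * y) := by
    rcases le_or_gt y (Real.log b₁) with h | h
    · have h1 := (hC₁ y h).trans (le_max_left _ 0)
      have : 0 ≤ K₂ * exp (γ₂ * y) := by positivity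
      linarith
    · have h1 := (hK (exp y) ((log_lt_iff_lt_exp hb₁).1 h)).2
      rw [← exp_mul, mul_comm y] at h1
      have := le_max_right C₁ 0
      linarith
  calc exp (r * y) * (B (exp y) * Wd U y)
      ≤ exp (r * y) * ((max C₁ 0 + K₂ * exp (γ₂ * y)) * Wd U y) := by gcongr
    _ = max C₁ 0 * (exp (r * y) * Wd U y) + K₂ * (exp ((r + γ₂) * y) * Wd U y) := by
        rw [add_mul r, exp_add]; ring
    _ ≤ _ := by
        have h1 := hD₁ y
        have h2 := hD₂ y
        have := le_max_right C₁ 0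
        gcongr

lemma decay_of {q : ℝ → ℝ} (hq0 : ∀ y, 0 ≤ q y) (hq : ∀ r, ∃ C, ∀ y, exp (r * y) * q y ≤ C) :
    ∃ C, 0 ≤ C ∧ ∀ y, q y ≤ C * exp (-|y|) := by
  obtain ⟨C1, h1⟩ := hq 1
  obtain ⟨C2, h2⟩ := hq (-1)
  refine ⟨max (max C1 C2) 0, le_max_right _ _, fun y => ?_⟩
  have e : q y = (exp (|y|) * q y) * exp (-|y|) := by
    rw [mul_right_comm, ← exp_add]; simp
  rw [e]
  refine mul_le_mul_of_nonneg_right (le_trans ?_ (le_max_left _ _)) (exp_pos _).le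
  rcases abs_cases y with ⟨h, -⟩ | ⟨h, -⟩
  · rw [h]; have := h1 y; rw [one_mul] at this; exact this.trans (le_max_left _ _)
  · rw [h]; have := h2 y; rw [neg_one_mul] at this; exact this.trans (le_max_right _ _)

lemma decay_int {q : ℝ → ℝ} {C L R : ℝ} (hC : 0 ≤ C) (hL : 0 < L)
    (hq : ∀ y, q y ≤ C * exp (-|y|)) (y : ℝ) (hy : |y| ≤ R) (n : ℤ) :
    q (y + n * L) ≤ C * exp R * exp (-(|(n:ℝ)| * L)) := by
  refine (hq _).trans ?_
  rw [mul_assoc, ← exp_add]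
  refine mul_le_mul_of_nonneg_left (exp_le_exp.2 ?_) hC
  have h1 : |(n:ℝ) * L| ≤ |y + n * L| + |y| := by
    have := abs_sub (y + n * L) y
    simpa using this
  rw [abs_mul, abs_of_pos hL] at h1
  linarith

lemma summable_exp_int {L : ℝ} (hL : 0 < L) (D : ℝ) :
    Summable (fun n : ℤ => D * exp (-(|(n:ℝ)| * L))) := by
  refine Summable.mul_left D ?_
  have h : Summable (fun n : ℕ => exp (-(n * L))) := by
    have := summable_geometric_of_lt_one (exp_pos (-L)).le (by simpa using hL)
    refine this.congr (fun n => ?_)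
    rw [← exp_nat_mul]; congr 1; ring
  refine Summable.of_nat_of_neg ?_ ?_
  · refine h.congr (fun n => by simp)
  · refine h.congr (fun n => by simp)

lemma tel_int (b : ℕ) (f : ℤ → ℝ) : ∑ n ∈ Finset.Ico (-b : ℤ) b, (f (n+1) - f n) = f b - f (-b) := by
  have := Finset.sum_Ico_int_sub b f
  rw [← neg_sub (f (-(b:ℤ))), ← this, ← Finset.sum_neg_distrib]
  exact Finset.sum_congr rfl (fun n _ => (neg_sub _ _).symm)

lemma Wd_sum_const {b W : ℝ → ℝ} {L : ℝ} (hL : 0 < L) (hW0 : ∀ y, 0 ≤ W y)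
    (hq0 : ∀ y, 0 ≤ b y * W y)
    (hWd : ∀ y, HasDerivAt W (b (y + L) * W (y + L) - b y * W y) y)
    (hW : ∀ r, ∃ C, ∀ y, exp (r * y) * W y ≤ C)
    (hbW : ∀ r, ∃ C, ∀ y, exp (r * y) * (b y * W y) ≤ C) (y : ℝ) :
    HasSum (fun n : ℤ => W (y + n * L)) (∑' n : ℤ, W (0 + n * L)) := by
  obtain ⟨C, hC, hWC⟩ := decay_of hW0 hW
  obtain ⟨C', hC', hqC⟩ := decay_of hq0 hbW
  have hs : ∀ y, Summable (fun n : ℤ => W (y + n * L)) := fun y =>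
    Summable.of_nonneg_of_le (fun _ => hW0 _) (fun n => decay_int hC hL hWC y le_rfl n)
      (summable_exp_int hL _)
  have ht := (hs y).hasSum.sub (hs 0).hasSum
  have h0 : Tendsto (fun N : ℕ => ∑ n ∈ Finset.Ico (-N : ℤ) N, (W (y + n * L) - W (0 + n * L)))
      atTop (𝓝 0) := by
    have hd : ∀ (N : ℕ) (s : ℝ), HasDerivAt (fun s => ∑ n ∈ Finset.Ico (-N : ℤ) N, W (s + n * L))
        (b (s + N * L) * W (s + N * L) - b (s + (-N) * L) * W (s + (-N) * L)) s := by
      intro N s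
      refine HasDerivAt.congr_deriv (HasDerivAt.fun_sum fun n _ => (hWd (s + n * L)).comp_add_const s _) ?_
      have := tel_int N (fun n => b (s + n * L) * W (s + n * L))
      push_cast at this
      rw [← this]
      refine Finset.sum_congr rfl (fun n _ => ?_)
      have e : s + n * L + L = s + (n + 1) * L := by ring
      rw [e]
    have hlim : Tendsto (fun N : ℕ => 2 * (C' * exp |y| * exp (-(|((N:ℤ):ℝ)| * L))) * |y|) atTop (𝓝 0) := by
      have h := (summable_exp_int hL (C' * exp |y|)).tendsto_cofinite_zero
      have h2 := h.comp ((Nat.cast_injective (R := ℤ)).tendsto_cofinite)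
      rw [Nat.cofinite_eq_atTop] at h2
      simpa using (h2.const_mul 2).mul_const |y|
    rw [tendsto_zero_iff_norm_tendsto_zero]
    refine squeeze_zero (fun _ => norm_nonneg _) (fun N => ?_) hlim
    have key := (convex_uIcc 0 y).norm_image_sub_le_of_norm_hasDerivWithin_le
      (f := (fun s => ∑ n ∈ Finset.Ico (-N : ℤ) N, W (s + n * L)))
      (C := 2 * (C' * exp |y| * exp (-(|((N:ℤ):ℝ)| * L))))
      (fun s _ => (hd N s).hasDerivWithinAt) ?_ (left_mem_uIcc) (right_mem_uIcc)
    · rw [Finset.sum_sub_distrib]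
      refine key.trans (le_of_eq ?_)
      rw [sub_zero, Real.norm_eq_abs]
    · intro s hs
      have hs' : |s| ≤ |y| := by
        have := abs_sub_left_of_mem_uIcc hs
        simpa using this
      have a1 := decay_int hC' hL hqC s hs' N
      have a2 := decay_int hC' hL hqC s hs' (-N)
      have a3 := hq0 (s + (N:ℤ) * L)
      have a4 := hq0 (s + (-N : ℤ) * L)
      push_cast at a1 a2 a3 a4 ⊢
      rw [abs_neg] at a2
      rw [Real.norm_eq_abs, abs_le]
      constructor <;> linarith
  have hlim2 : Tendsto (fun N : ℕ => ∑ n ∈ Finset.Ico (-N : ℤ) N, (W (y + n * L) - W (0 + n * L)))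
      atTop (𝓝 (∑' n : ℤ, W (y + n * L) - ∑' n : ℤ, W (0 + n * L))) :=
    ht.comp (Finset.tendsto_Ico_neg_atTop_atTop.comp tendsto_natCast_atTop_atTop)
  have := tendsto_nhds_unique h0 hlim2
  rw [← sub_eq_zero.1 this.symm]
  exact (hs y).hasSum

lemma integral_exp_cov {E : Type*} [NormedAddCommGroup E] [NormedSpace ℝ E] (g : ℝ → E) :
    ∫ x in Ioi (0:ℝ), g x = ∫ y, exp y • g (exp y) := by
  have := integral_image_eq_integral_abs_deriv_smul (s := univ) (f := exp) (f' := exp)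
    MeasurableSet.univ (fun x _ => (Real.hasDerivAt_exp x).hasDerivWithinAt)
    (exp_injective.injOn) g
  rw [image_univ, Real.range_exp] at this
  rw [this]
  simp [abs_of_pos (exp_pos _)]

lemma Wd_sum_one {W : ℝ → ℝ} {L : ℝ} (hL : 0 < L) (hWc : Continuous W) (hW0 : ∀ y, 0 ≤ W y)
    (hW : ∀ r, ∃ C, ∀ y, exp (r * y) * W y ≤ C) (hi : Integrable W) (hI : ∫ y, W y = L) {S : ℝ}
    (hS : ∀ y, HasSum (fun n : ℤ => W (y + n * L)) S) : S = 1 := by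
  obtain ⟨C, hC, hWC⟩ := decay_of hW0 hW
  have hi' : Integrable (fun u => W (u * L)) := hi.comp_mul_right' hL.ne'
  have h1 := hi'.hasSum_intervalIntegral_comp_add_int
  have e1 : ∫ u, W (u * L) = 1 := by
    rw [Measure.integral_comp_mul_right W L, hI, smul_eq_mul, abs_of_pos (inv_pos.2 hL)]
    exact inv_mul_cancel₀ hL.ne'
  rw [e1] at h1
  have h2 : HasSum (fun n : ℤ => ∫ x in (0 : ℝ)..(1 : ℝ), W ((x + n) * L))
      (∫ x in (0:ℝ)..1, S) := by
    refine intervalIntegral.hasSum_integral_of_dominated_convergence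
      (fun n _ => C * exp L * exp (-(|(n:ℝ)| * L))) (fun n => ?_) (fun n => ?_) ?_ ?_ ?_
    · exact (hWc.comp (by fun_prop : Continuous fun x : ℝ => (x + n) * L)).aestronglyMeasurable
    · refine Eventually.of_forall (fun x hx => ?_)
      rw [uIoc_of_le zero_le_one] at hx
      rw [Real.norm_of_nonneg (hW0 _), add_mul]
      refine decay_int hC hL hWC _ ?_ n
      rw [abs_of_nonneg (mul_nonneg hx.1.le hL.le)]
      nlinarith [hx.2]
    · exact Eventually.of_forall (fun x _ => summable_exp_int hL _)
    · exact intervalIntegrable_const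
    · refine Eventually.of_forall (fun x _ => ?_)
      simpa [add_mul] using hS (x * L)
  have := h2.unique h1
  simpa using this

theorem mkHypW (hB : Bhyp B) (hB2 : HypA2 B) (hU : Perron B U U') :
    HypW (fun y => B (exp y)) (Real.log 2) (Wd U) := by
  have hc : Continuous (Wd U) := continuous_iff_continuousAt.2 fun y => (Wd_deriv hU y).continuousAt
  have hq0 : ∀ y, 0 ≤ B (exp y) * Wd U y := fun y => mul_nonneg (hB.2.1 _ (exp_pos _)) (Wd_nonneg hU y)
  have hS := Wd_sum_const (b := fun y => B (exp y)) log2_pos (Wd_nonneg hU) hq0 (Wd_deriv hU)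
    (Wd_exp_bdd hU) (bWd_exp_bdd hB hB2 hU)
  have hI : ∫ y, Wd U y = Real.log 2 := by
    have h1 := hU.2.2.2.2.1
    rw [integral_exp_cov] at h1
    have : ∀ y, Wd U y = Real.log 2 * (exp y • (exp y * U (exp y))) := by
      intro y
      rw [Wd, smul_eq_mul, two_mul, exp_add]; ring
    simp_rw [this]
    rw [integral_const_mul, h1, mul_one]
  have hi : Integrable (Wd U) := by
    by_contra h
    rw [integral_undef h] at hI
    exact log2_pos.ne hI
  have h1 := Wd_sum_one log2_pos hc (Wd_nonneg hU) (Wd_exp_bdd hU) hi hI hS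
  rw [h1] at hS
  exact { toHypB := mkHypB hB, hW0 := Wd_nonneg hU, hWd := Wd_deriv hU, hWs := hS }

lemma supp_dense {β : ℝ} (hβ : closure {x : ℝ | 0 < x ∧ B x ≠ 0} = Ici β) {u v : ℝ}
    (huv : u < v) (hβv : β < v) : ∃ x, u < x ∧ x < v ∧ B x ≠ 0 := by
  obtain ⟨p, hp1, hp2⟩ := exists_between (max_lt huv hβv)
  have hp : p ∈ closure {x : ℝ | 0 < x ∧ B x ≠ 0} := by
    rw [hβ]; exact ((le_max_right _ _).trans hp1.le)
  obtain ⟨x, hx1, hx2⟩ := mem_closure_iff.1 hp (Ioo (max u β) v) isOpen_Ioo ⟨hp1, hp2⟩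
  exact ⟨x, (le_max_left _ _).trans_lt hx1.1, hx1.2, hx2.2⟩

theorem mkHypD (hB : Bhyp B) (hB2 : HypA2 B) (hU : Perron B U U') :
    HypD (fun y => B (exp y)) (Real.log 2) (Wd U) := by
  have h := mkHypW hB hB2 hU
  obtain ⟨β, hβ0, hβ⟩ := hB2.2.1
  refine { toHypW := h, hD := ⟨fun z => β < 2 * exp z, ?_, ?_, ?_⟩ }
  · intro z hz
    have hc : Continuous (Wd U) := continuous_iff_continuousAt.2 fun y => (h.hWd y).continuousAt
    constructor
    · obtain ⟨x, hx1, hx2, hx3⟩ := supp_dense hβ (by linarith [exp_pos z] : exp z < 2 * exp z) hz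
      have hx0 : 0 < x := (exp_pos z).trans hx1
      refine ⟨Real.log x - z, ⟨?_, ?_⟩, ?_⟩
      · linarith [(lt_log_iff_exp_lt hx0).2 hx1]
      · rw [← exp_add_log2, ← log_lt_iff_lt_exp hx0] at hx2; linarith
      · rw [add_sub_cancel, exp_log hx0]
        exact lt_of_le_of_ne (hB.2.1 x hx0) hx3.symm
    · by_contra hcon
      have hz0 : Wd U z = 0 := le_antisymm (not_lt.1 hcon) (h.hW0 z)
      have step : ∀ z, β < 2 * exp z → Wd U z = 0 → Wd U (z + Real.log 2) = 0 := by
        intro z hz hz0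
        have below : ∀ y ≤ z, Wd U y = 0 := by
          intro y hy
          have h1 := dom h 0 y (z - y) (by linarith)
          simp only [zero_add, Finset.range_one, Finset.sum_singleton, Nat.cast_zero, zero_mul,
            add_zero, add_sub_cancel, hz0] at h1
          have h2 : 0 < pk (fun y => B (exp y)) (Real.log 2) 0 y (z - y) := by
            simp only [pk]; exact exp_pos _
          refine le_antisymm ?_ (h.hW0 y)
          by_contra h3
          push Not at h3
          exact absurd h1 (not_le.2 (mul_pos h3 h2))
        have hq : ∀ y < z, B (exp (y + Real.log 2)) * Wd U (y + Real.log 2) = 0 := by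
          intro y hy
          have h1 := h.hWd y
          have h2 : HasDerivAt (Wd U) 0 y := by
            refine (hasDerivAt_const y (0:ℝ)).congr_of_eventuallyEq ?_
            filter_upwards [Iio_mem_nhds hy] with w hw
            exact below w (le_of_lt hw)
          have h3 := h1.unique h2
          rw [below y hy.le, mul_zero, sub_zero] at h3
          exact h3
        by_contra hne
        have hev : ∀ᶠ w in 𝓝 (z + Real.log 2), Wd U w ≠ 0 := hc.continuousAt.eventually_ne hne
        obtain ⟨δ, hδ, hball⟩ := Metric.eventually_nhds_iff.1 hev
        have e1 : exp (z + Real.log 2 - δ) < 2 * exp z := by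
          rw [← exp_add_log2]; exact exp_lt_exp.2 (by linarith)
        obtain ⟨x, hx1, hx2, hx3⟩ := supp_dense hβ e1 hz
        have hx0 : 0 < x := (exp_pos _).trans hx1
        have a1 := (lt_log_iff_exp_lt hx0).2 hx1
        rw [← exp_add_log2, ← log_lt_iff_lt_exp hx0] at hx2
        have h4 := hq (Real.log x - Real.log 2) (by linarith)
        rw [sub_add_cancel, exp_log hx0] at h4
        rcases mul_eq_zero.1 h4 with h5 | h5
        · exact hx3 h5
        · refine hball ?_ h5
          rw [Real.dist_eq, abs_lt]; constructor <;> linarith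
      have up : ∀ n : ℕ, Wd U (z + n * Real.log 2) = 0 := by
        intro n
        induction n with
        | zero => simpa using hz0
        | succ n ih =>
          have := step (z + n * Real.log 2) (hz.trans_le (by
            have : exp z ≤ exp (z + n * Real.log 2) :=
              exp_le_exp.2 (by have := log2_pos; have : 0 ≤ n * Real.log 2 := by positivity
                               linarith)
            linarith)) ih
          rw [← this]; congr 1; push_cast; ring
      have all : ∀ n : ℤ, Wd U (z + n * Real.log 2) = 0 := by
        intro n
        have h1 := dom h 0 (z + n * Real.log 2) ((n.natAbs - n) * Real.log 2)
          (mul_nonneg (by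
            have : n ≤ (n.natAbs : ℤ) := Int.le_natAbs
            have h' : (n:ℝ) ≤ ((n.natAbs : ℤ) : ℝ) := Int.cast_le.2 this
            rw [Int.cast_natCast] at h'
            linarith) log2_pos.le)
        have e : z + n * Real.log 2 + (n.natAbs - n) * Real.log 2 = z + n.natAbs * Real.log 2 := by ring
        simp only [zero_add, Finset.range_one, Finset.sum_singleton, Nat.cast_zero, zero_mul,
            add_zero, e, up] at h1
        refine le_antisymm ?_ (h.hW0 _)
        by_contra h3
        push Not at h3
        refine absurd h1 (not_le.2 (mul_pos h3 ?_))
        simp only [pk]; exact exp_pos _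
      have := h.hWs z
      simp only [all] at this
      exact zero_ne_one (hasSum_zero.unique this)
  · intro z hz s hs
    push Not at hz
    have hle : exp (z + s) ≤ β := by
      refine le_trans ?_ hz
      rw [← exp_add_log2]; exact exp_le_exp.2 (by linarith [hs.2])
    have hz0 : ∀ x, 0 < x → x < β → B x = 0 := by
      intro x hx hxβ
      by_contra hne
      have : x ∈ closure {x : ℝ | 0 < x ∧ B x ≠ 0} := subset_closure ⟨hx, hne⟩
      rw [hβ] at this
      exact absurd hxβ (not_lt.2 this)
    rcases hle.lt_or_eq with hlt | heq
    · exact hz0 _ (exp_pos _) hlt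
    · have hcont := h.hb.continuousAt (x := z + s)
      have hl : Tendsto (fun y => B (exp y)) (𝓝[<] (z+s)) (𝓝 (B (exp (z+s)))) :=
        hcont.tendsto.mono_left nhdsWithin_le_nhds
      refine tendsto_nhds_unique hl ?_
      refine tendsto_const_nhds.congr' ?_
      filter_upwards [self_mem_nhdsWithin] with y hy
      exact (hz0 _ (exp_pos _) (heq ▸ exp_lt_exp.2 hy)).symm
  · intro z
    obtain ⟨N, hN⟩ := exists_nat_gt ((β - z) / Real.log 2)
    refine ⟨N, ?_⟩
    rw [div_lt_iff₀ log2_pos] at hN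
    have := add_one_le_exp (z + N * Real.log 2)
    linarith [exp_pos (z + N * Real.log 2)]

end Mit

namespace Mit

/-- logarithmic image of the measure `x μ(dx)` on `(0,∞)` -/
def nu (μ : Measure ℝ) : Measure ℝ :=
  ((μ.restrict (Ioi 0)).withDensity (fun x => ENNReal.ofReal x)).map Real.log

lemma nu_finite {μ : Measure ℝ} (h : (∫⁻ x in Ioi 0, ENNReal.ofReal x ∂μ) < ⊤) :
    IsFiniteMeasure (nu μ) := by
  constructor
  rw [nu, Measure.map_apply Real.measurable_log MeasurableSet.univ, preimage_univ,
    withDensity_apply _ MeasurableSet.univ, Measure.restrict_univ]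
  exact h

lemma nu_int {E : Type*} [NormedAddCommGroup E] [NormedSpace ℝ E] (μ : Measure ℝ) {F : ℝ → E}
    (hF : StronglyMeasurable F) : ∫ y, F y ∂(nu μ) = ∫ x in Ioi 0, x • F (Real.log x) ∂μ := by
  rw [nu, integral_map Real.measurable_log.aemeasurable hF.aestronglyMeasurable,
    integral_withDensity_eq_integral_toReal_smul (by fun_prop) (by simp)]
  refine setIntegral_congr_fun measurableSet_Ioi (fun x hx => ?_)
  rw [ENNReal.toReal_ofReal (le_of_lt hx)]

/-- the limiting periodic family of measures -/
def rho (W : ℝ → ℝ) (L : ℝ) (μ : Measure ℝ) (t : ℝ) : Measure ℝ :=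
  Measure.sum fun n : ℤ => ((nu μ).withDensity
    (fun y => ENNReal.ofReal (W (y + t + n * L) * exp (-(y + t + n * L))))).map
      (fun y => exp (y + t + n * L))

lemma rho_periodic (W : ℝ → ℝ) (L : ℝ) (μ : Measure ℝ) (t : ℝ) :
    rho W L μ (t + L) = rho W L μ t := by
  have key : ∀ n : ℤ, ((nu μ).withDensity
    (fun y => ENNReal.ofReal (W (y + (t + L) + n * L) * exp (-(y + (t + L) + n * L))))).map
      (fun y => exp (y + (t + L) + n * L)) = ((nu μ).withDensity
    (fun y => ENNReal.ofReal (W (y + t + (n + 1 : ℤ) * L) * exp (-(y + t + (n + 1 : ℤ) * L))))).map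
      (fun y => exp (y + t + (n + 1 : ℤ) * L)) := by
    intro n
    have e : ∀ y : ℝ, y + (t + L) + n * L = y + t + (n + 1 : ℤ) * L := fun y => by push_cast; ring
    simp_rw [e]
  unfold rho
  simp_rw [key]
  ext s hs
  rw [Measure.sum_apply _ hs, Measure.sum_apply _ hs]
  exact (Equiv.addRight (1:ℤ)).tsum_eq (fun n : ℤ => (((nu μ).withDensity
    (fun y => ENNReal.ofReal (W (y + t + n * L) * exp (-(y + t + n * L))))).map
      (fun y => exp (y + t + n * L))) s)

variable {b W : ℝ → ℝ} {L : ℝ} {μ : Measure ℝ}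

lemma W_cont (h : HypW b L W) : Continuous W :=
  continuous_iff_continuousAt.2 fun y => (h.hWd y).continuousAt

lemma rho_finite (h : HypW b L W) (hμ : (∫⁻ x in Ioi 0, ENNReal.ofReal x ∂μ) < ⊤) (t : ℝ) :
    (∫⁻ x in Ioi 0, ENNReal.ofReal x ∂(rho W L μ t)) < ⊤ := by
  have := nu_finite hμ
  have hc := W_cont h
  refine lt_of_le_of_lt (lintegral_mono_set (subset_univ _)) ?_
  rw [Measure.restrict_univ, rho, lintegral_sum_measure]
  have e : ∀ n : ℤ, ∫⁻ x, ENNReal.ofReal x ∂(((nu μ).withDensity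
    (fun y => ENNReal.ofReal (W (y + t + n * L) * exp (-(y + t + n * L))))).map
      (fun y => exp (y + t + n * L))) = ∫⁻ y, ENNReal.ofReal (W (y + t + n * L)) ∂(nu μ) := by
    intro n
    have m1 : Measurable fun y => ENNReal.ofReal (W (y + t + n * L) * exp (-(y + t + n * L))) := by
      have := hc.measurable
      fun_prop
    rw [lintegral_map (by fun_prop) (by fun_prop),
      lintegral_withDensity_eq_lintegral_mul _ m1 (by fun_prop)]
    refine lintegral_congr (fun y => ?_)
    simp only [Pi.mul_apply]
    rw [← ENNReal.ofReal_mul (mul_nonneg (h.hW0 _) (exp_pos _).le), mul_assoc, ← exp_add,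
      neg_add_cancel, exp_zero, mul_one]
  simp_rw [e]
  rw [← lintegral_tsum (fun n => by have := hc.measurable; fun_prop)]
  have e2 : ∀ y, ∑' n : ℤ, ENNReal.ofReal (W (y + t + n * L)) = 1 := by
    intro y
    rw [← ENNReal.ofReal_tsum_of_nonneg (fun _ => h.hW0 _) (h.hWs _).summable, (h.hWs _).tsum_eq]
    simp
  simp_rw [e2]
  simp

lemma meas_hasSum {F : ℤ → ℝ → ℝ} {G : ℝ → ℝ} (hF : ∀ n, Measurable (F n))
    (h : ∀ y, HasSum (fun n => F n y) (G y)) : Measurable G := by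
  refine measurable_of_tendsto_metrizable (f := fun N : ℕ => fun y =>
    ∑ n ∈ Finset.Icc (-N : ℤ) N, F n y) (fun N => by fun_prop) ?_
  rw [tendsto_pi_nhds]
  intro y
  exact (h y).comp (Finset.tendsto_Icc_neg_atTop_atTop.comp tendsto_natCast_atTop_atTop)

lemma Av_meas (h : HypW b L W) {g : ℝ → ℝ} {C : ℝ} (hg : ∀ z, |g z| ≤ C) (hgm : Measurable g) :
    Measurable (Av W L g) := by
  have := (W_cont h).measurable
  exact meas_hasSum (F := fun n y => W (y + n * L) * g (y + n * L)) (fun n => by fun_prop)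
    (fun y => Av_hasSum h hg y)

lemma Pt_meas (h : HypB b L) {g : ℝ → ℝ} {C t : ℝ} (ht : 0 ≤ t) (hg : ∀ z, |g z| ≤ C)
    (hgm : Measurable g) : Measurable (Pt b L t g) := by
  refine meas_hasSum (F := fun n y => Kz b L t y n * g (y + t + n * L)) (fun n => ?_)
    (fun y => Pt_hasSum h ht hg y)
  have : Measurable (fun y => Kz b L t y n) := by
    unfold Kz
    split_ifs
    · exact (pk_continuous_y h.hb _ _).measurable
    · exact measurable_const
  fun_prop

lemma rho_int (h : HypW b L W) (hμ : (∫⁻ x in Ioi 0, ENNReal.ofReal x ∂μ) < ⊤) {f : ℝ → ℝ}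
    (hf : ContinuousOn f (Ioi 0)) {C : ℝ} (hg : ∀ z, |f (exp z) * exp (-z)| ≤ C) (t : ℝ) :
    ∫ x in Ioi 0, f x ∂(rho W L μ t)
      = ∫ y, Av W L (fun z => f (exp z) * exp (-z)) (y + t) ∂(nu μ) := by
  classical
  have := nu_finite hμ
  have hc := (W_cont h).measurable
  set g : ℝ → ℝ := fun z => f (exp z) * exp (-z) with hgdef
  have hgc : Continuous g :=
    (hf.comp_continuous continuous_exp (fun y => exp_pos y)).mul (by fun_prop)
  have hgm := hgc.measurable
  have hC : 0 ≤ C := (abs_nonneg _).trans (hg 0)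
  set f0 : ℝ → ℝ := (Ioi (0:ℝ)).indicator f with hf0
  have hf0m : Measurable f0 := by
    have := hf.measurable_piecewise (continuousOn_const (c := (0:ℝ))) (measurableSet_Ioi (a := (0:ℝ)))
    exact (congrArg Measurable Set.piecewise_eq_indicator).mp this
  have hf0i : Integrable f0 (rho W L μ t) := by
    refine ⟨hf0m.aestronglyMeasurable, ?_⟩
    refine lt_of_le_of_lt (b := ∫⁻ x, (Ioi (0:ℝ)).indicator (fun x => ENNReal.ofReal C * ENNReal.ofReal x) x
      ∂(rho W L μ t)) (lintegral_mono fun x => ?_) ?_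
    · by_cases hx : x ∈ Ioi (0:ℝ)
      · rw [hf0, indicator_of_mem hx, indicator_of_mem hx, ← ENNReal.ofReal_mul hC,
          ← ofReal_norm]
        refine ENNReal.ofReal_le_ofReal ?_
        have h1 := hg (Real.log x)
        rw [exp_log hx, exp_neg, exp_log hx, abs_mul, abs_inv, abs_of_pos (mem_Ioi.1 hx), ← div_eq_mul_inv,
          div_le_iff₀ hx] at h1
        exact h1
      · rw [hf0, indicator_of_notMem hx]; simp
    · rw [lintegral_indicator measurableSet_Ioi, lintegral_const_mul _ (by fun_prop)]
      exact ENNReal.mul_lt_top ENNReal.ofReal_lt_top (rho_finite h hμ t)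
  rw [← integral_indicator measurableSet_Ioi]
  have h1 := hasSum_integral_measure (f := f0) hf0i
  have e : ∀ n : ℤ, ∫ x, f0 x ∂(((nu μ).withDensity
    (fun y => ENNReal.ofReal (W (y + t + n * L) * exp (-(y + t + n * L))))).map
      (fun y => exp (y + t + n * L))) = ∫ y, W (y + t + n * L) * g (y + t + n * L) ∂(nu μ) := by
    intro n
    rw [integral_map (by fun_prop) hf0m.aestronglyMeasurable,
      integral_withDensity_eq_integral_toReal_smul (by fun_prop) (by simp)]
    refine integral_congr_ae (Eventually.of_forall fun y => ?_)
    simp only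
    rw [ENNReal.toReal_ofReal (mul_nonneg (h.hW0 _) (exp_pos _).le), hf0,
      indicator_of_mem (mem_Ioi.2 (exp_pos _)), hgdef, smul_eq_mul]
    ring
  have h1' := hs_congr h1 e rfl
  refine h1'.unique ?_
  refine hasSum_integral_of_dominated_convergence (fun n y => W (y + t + n * L) * C) (fun n => ?_)
    (fun n => ?_) ?_ ?_ ?_
  · exact (by fun_prop : Measurable fun y => W (y + t + n * L) * g (y + t + n * L)).aestronglyMeasurable
  · refine Eventually.of_forall fun y => ?_
    rw [norm_mul, Real.norm_of_nonneg (h.hW0 _)]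
    exact mul_le_mul_of_nonneg_left (hg _) (h.hW0 _)
  · exact Eventually.of_forall fun y => (h.hWs _).summable.mul_right C
  · have : ∀ y, ∑' n : ℤ, W (y + t + n * L) * C = C := fun y => by
      rw [tsum_mul_right, (h.hWs _).tsum_eq, one_mul]
    simp_rw [this]
    exact integrable_const C
  · exact Eventually.of_forall fun y => Av_hasSum h hg (y + t)

lemma g_bdd {f : ℝ → ℝ} (hf : ContinuousOn f (Ioi 0))
    (h0 : Tendsto (fun x => f x / x) (nhdsWithin 0 (Ioi 0)) (nhds 0))
    (h1 : Tendsto (fun x => f x / x) atTop (nhds 0)) :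
    ∃ C, ∀ z, |f (exp z) * exp (-z)| ≤ C := by
  have hgc : Continuous (fun z => f (exp z) * exp (-z)) :=
    (hf.comp_continuous continuous_exp (fun y => exp_pos y)).mul (by fun_prop)
  have e : (fun z => f (exp z) * exp (-z)) = (fun x => f x / x) ∘ exp := by
    funext z; simp [exp_neg, div_eq_mul_inv]
  have a0 : Tendsto (fun z => f (exp z) * exp (-z)) atBot (𝓝 0) := by
    rw [e]; exact h0.comp tendsto_exp_atBot_nhdsGT
  have a1 : Tendsto (fun z => f (exp z) * exp (-z)) atTop (𝓝 0) := by
    rw [e]; exact h1.comp tendsto_exp_atTop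
  have c0 := (tendsto_order.1 a0.abs).2 1 (by simp)
  have c1 := (tendsto_order.1 a1.abs).2 1 (by simp)
  obtain ⟨u, hu⟩ := eventually_atBot.1 c0
  obtain ⟨v, hv⟩ := eventually_atTop.1 c1
  obtain ⟨C', hC'⟩ := (isCompact_Icc (a := u) (b := v)).exists_bound_of_continuousOn
    hgc.continuousOn
  refine ⟨max 1 C', fun z => ?_⟩
  rcases le_or_gt z u with h | h
  · exact (hu z h).le.trans (le_max_left _ _)
  rcases le_or_gt v z with h' | h'
  · exact (hv z h').le.trans (le_max_left _ _)
  · exact (hC' z ⟨h.le, h'.le⟩).trans (le_max_right _ _)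

lemma f_locBdd {f : ℝ → ℝ} {C : ℝ} (hg : ∀ z, |f (exp z) * exp (-z)| ≤ C) :
    (∀ x > 0, |f x| ≤ C * x) ∧ LocBddOn f := by
  have hC : 0 ≤ C := (abs_nonneg _).trans (hg 0)
  have h : ∀ x > 0, |f x| ≤ C * x := by
    intro x hx
    have h1 := hg (Real.log x)
    rwa [exp_log hx, exp_neg, exp_log hx, abs_mul, abs_inv, abs_of_pos hx, ← div_eq_mul_inv,
          div_le_iff₀ hx] at h1
  exact ⟨h, fun r _ => ⟨C * r, fun x hx hxr => (h x hx).trans (mul_le_mul_of_nonneg_left hxr hC)⟩⟩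

theorem conv_one {B f : ℝ → ℝ} {φ : ℝ → ℝ → ℝ} (h : HypD (fun y => B (exp y)) (Real.log 2) W)
    (hl : LocBdd2 φ) (hm : IsMildSol B f φ) (hf : ContinuousOn f (Ioi 0)) {C : ℝ}
    (hg : ∀ z, |f (exp z) * exp (-z)| ≤ C)
    (hμ : (∫⁻ x in Ioi 0, ENNReal.ofReal x ∂μ) < ⊤) :
    Tendsto (fun t => exp (-t) * (∫ x in Ioi 0, φ t x ∂μ)
      - ∫ x in Ioi 0, f x ∂(rho W (Real.log 2) μ t)) atTop (𝓝 0) := by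
  have := nu_finite hμ
  have hW := h.toHypW
  have hB := hW.toHypB
  set g : ℝ → ℝ := fun z => f (exp z) * exp (-z) with hgdef
  have hgc : Continuous g :=
    (hf.comp_continuous continuous_exp (fun y => exp_pos y)).mul (by fun_prop)
  have hgm := hgc.measurable
  set P := Pt (fun y => B (exp y)) (Real.log 2) with hP
  have key : Tendsto (fun t => ∫ y, (P t g y - Av W (Real.log 2) g (y + t)) ∂(nu μ)) atTop
      (𝓝 (∫ _, (0:ℝ) ∂(nu μ))) := by
    refine tendsto_integral_filter_of_dominated_convergence (fun _ => C + C) ?_ ?_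
      (integrable_const _) ?_
    · filter_upwards [eventually_ge_atTop 0] with t ht
      exact ((Pt_meas hB ht hg hgm).sub ((Av_meas hW hg hgm).comp (measurable_add_const t))).aestronglyMeasurable
    · filter_upwards [eventually_ge_atTop 0] with t ht
      refine Eventually.of_forall fun y => ?_
      exact (norm_sub_le _ _).trans (add_le_add (Pt_bdd hB ht hg y) (Av_bdd hW hg _))
    · exact Eventually.of_forall fun y => Pt_tendsto h hg y
  rw [integral_zero] at key
  refine key.congr' ?_
  filter_upwards [eventually_ge_atTop 0] with t ht
  have mP := Pt_meas hB ht hg hgm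
  have mA : Measurable fun y => Av W (Real.log 2) g (y + t) :=
    (Av_meas hW hg hgm).comp (measurable_add_const t)
  rw [integral_sub, rho_int hW hμ hf hg t, nu_int μ mP.stronglyMeasurable, ← integral_const_mul]
  · congr 1
    refine setIntegral_congr_fun measurableSet_Ioi (fun x hx => ?_)
    have := M_eq_Pt hB hl hm hg (Real.log x) t ht
    rw [exp_log hx] at this
    simp only [smul_eq_mul]
    rw [this, mul_assoc, ← mul_assoc (exp (-t)), ← exp_add]
    simp [hP, hgdef]
  · exact Integrable.of_bound mP.aestronglyMeasurable C (Eventually.of_forall fun y => Pt_bdd hB ht hg y)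
  · exact Integrable.of_bound mA.aestronglyMeasurable C (Eventually.of_forall fun y => Av_bdd hW hg _)

end Mit

namespace Mit
open scoped FourierTransform
open TopologicalSpace (Compacts)

lemma four_norm {h : C(ℝ, ℂ)} {D a : ℝ} (ha : 0 < a) (hh : ∀ u, ‖h u‖ ≤ D * exp (-(a * |u|)))
    (K : Compacts ℝ) : Summable fun n : ℤ => ‖(h.comp (ContinuousMap.addRight (n : ℝ))).restrict K‖ := by
  have hD : 0 ≤ D := by
    have := (norm_nonneg _).trans (hh 0)
    simpa using this
  obtain ⟨R, hR⟩ := K.isCompact.isBounded.exists_norm_le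
  refine Summable.of_nonneg_of_le (fun n => norm_nonneg _) (fun n => ?_)
    (summable_exp_int ha (D * exp (a * R)))
  rw [ContinuousMap.norm_le _ (by positivity)]
  rintro ⟨x, hx⟩
  have hx2 : |x| ≤ R := hR x hx
  simp only [ContinuousMap.restrict_apply, ContinuousMap.comp_apply, ContinuousMap.coe_addRight]
  refine (hh _).trans ?_
  rw [mul_assoc, ← exp_add]
  refine mul_le_mul_of_nonneg_left (exp_le_exp.2 ?_) hD
  have : |(n : ℝ)| ≤ |x + n| + |x| := by
    have := abs_add_le (x + n) (-x)
    simpa using this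
  nlinarith

lemma four_int {h : C(ℝ, ℂ)} {D a : ℝ} (ha : 0 < a) (hh : ∀ u, ‖h u‖ ≤ D * exp (-(a * |u|))) :
    Integrable h :=
  Real.integrable_of_summable_norm_Icc (four_norm ha hh ⟨Icc 0 1, isCompact_Icc⟩)

lemma four_sq {h : C(ℝ, ℂ)} {D a : ℝ} (ha : 0 < a) (hh : ∀ u, ‖h u‖ ≤ D * exp (-(a * |u|))) :
    Summable fun n : ℤ => ‖𝓕 (h : ℝ → ℂ) n‖ ^ 2 := by
  let F : C(UnitAddCircle, ℂ) :=
    ⟨(h.periodic_tsum_comp_add_zsmul 1).lift, continuous_coinduced_dom.mpr (map_continuous _)⟩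
  have h1 := (hasSum_sq_fourierCoeff (ContinuousMap.toLp (E := ℂ) 2 AddCircle.haarAddCircle ℂ F)).summable
  refine h1.congr (fun n => ?_)
  rw [fourierCoeff_toLp, ← Real.fourierCoeff_tsum_comp_add (four_norm ha hh)]
  rfl

lemma four_sum {h h' : ℝ → ℂ} {D a : ℝ} (ha : 0 < a) (hd : ∀ u, HasDerivAt h (h' u) u)
    (hc : Continuous h') (hh : ∀ u, ‖h u‖ ≤ D * exp (-(a * |u|)))
    (hh' : ∀ u, ‖h' u‖ ≤ D * exp (-(a * |u|))) :
    Summable fun n : ℤ => 𝓕 h n := by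
  have hcont : Continuous h := continuous_iff_continuousAt.2 fun u => (hd u).continuousAt
  have hder : deriv h = h' := funext fun u => (hd u).deriv
  have i1 : Integrable h := four_int (h := ⟨h, hcont⟩) ha hh
  have i2 : Integrable h' := four_int (h := ⟨h', hc⟩) ha hh'
  have hF := Real.fourier_deriv i1 (fun u => (hd u).differentiableAt) (by rw [hder]; exact i2)
  rw [hder] at hF
  have hsq : Summable fun n : ℤ => ‖𝓕 h' n‖ ^ 2 := four_sq (h := ⟨h', hc⟩) ha hh'
  have hs2 : Summable fun n : ℤ => 1 / (n : ℝ) ^ 2 :=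
    Real.summable_one_div_int_pow.2 (by norm_num)
  refine Summable.of_norm_bounded_eventually (hsq.add hs2) ?_
  have : {(0 : ℤ)}ᶜ ∈ (cofinite : Filter ℤ) := (Set.finite_singleton (0 : ℤ)).compl_mem_cofinite
  filter_upwards [this] with n hn
  have hn0 : n ≠ 0 := hn
  have hnr : (1 : ℝ) ≤ |(n : ℝ)| := by exact_mod_cast Int.one_le_abs hn0
  rw [congrFun hF]
  simp only [norm_smul, norm_mul, Complex.norm_I, Complex.norm_real, norm_eq_abs, abs_of_pos pi_pos, Complex.norm_ofNat]
  set c := ‖𝓕 h (n : ℝ)‖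
  have hc0 : 0 ≤ c := norm_nonneg _
  have e1 : (1 : ℝ) / (n : ℝ) ^ 2 = (1 / |(n : ℝ)|) ^ 2 := by rw [div_pow, sq_abs, one_pow]
  rw [e1]
  have hp : 0 < |(n : ℝ)| := by linarith
  have key : c * (|(n : ℝ)| * (1 / |(n : ℝ)|)) = c := by field_simp
  have h3 := pi_gt_three
  have hA : c * |(n : ℝ)| ≤ 2 * π * 1 * |(n : ℝ)| * c := by
    have : 0 ≤ c * |(n : ℝ)| := by positivity
    nlinarith
  have hA0 : 0 ≤ c * |(n : ℝ)| := by positivity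
  have hq : (c * |(n : ℝ)|) ^ 2 ≤ (2 * π * 1 * |(n : ℝ)| * c) ^ 2 := pow_le_pow_left₀ hA0 hA 2
  have : c = (c * |(n : ℝ)|) * (1 / |(n : ℝ)|) := by rw [mul_assoc, key]
  nlinarith [sq_nonneg (c * |(n : ℝ)| - 1 / |(n : ℝ)|), sq_nonneg (c * |(n : ℝ)|), sq_nonneg (1 / |(n : ℝ)|)]

lemma poisson {h h' : ℝ → ℂ} {D a : ℝ} (ha : 0 < a) (hd : ∀ u, HasDerivAt h (h' u) u)
    (hc : Continuous h') (hh : ∀ u, ‖h u‖ ≤ D * exp (-(a * |u|)))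
    (hh' : ∀ u, ‖h' u‖ ≤ D * exp (-(a * |u|))) (x : ℝ) :
    HasSum (fun n : ℤ => 𝓕 h n * Complex.exp (((2 * π * n * x : ℝ) : ℂ) * Complex.I))
      (∑' n : ℤ, h (x + n)) := by
  have hcont : Continuous h := continuous_iff_continuousAt.2 fun u => (hd u).continuousAt
  have hs := four_sum ha hd hc hh hh'
  have hp := Real.tsum_eq_tsum_fourier (f := ⟨h, hcont⟩) (four_norm ha hh) hs x
  have e : ∀ n : ℤ, 𝓕 h n * fourier n (x : UnitAddCircle)
      = 𝓕 h n * Complex.exp (((2 * π * n * x : ℝ) : ℂ) * Complex.I) := by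
    intro n
    rw [fourier_coe_apply]
    congr 2
    push_cast
    ring
  have hs2 : Summable fun n : ℤ => 𝓕 h n * Complex.exp (((2 * π * n * x : ℝ) : ℂ) * Complex.I) := by
    refine Summable.of_norm (hs.norm.congr fun n => ?_)
    rw [norm_mul, Complex.norm_exp_ofReal_mul_I, mul_one]
  have hp2 : ∑' n : ℤ, h (x + n) = ∑' n : ℤ, 𝓕 h n * fourier n (x : UnitAddCircle) := hp
  rw [hp2, tsum_congr e]
  exact hs2.hasSum

/-- Cesaro summation of a summable bilateral series. -/
lemma cesaro {a : ℤ → ℂ} {s : ℂ} (h : HasSum a s) :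
    Tendsto (fun N : ℕ => ∑ k ∈ Finset.Icc (-(N : ℤ)) (N : ℤ),
      (((1 : ℝ) - (|k| : ℝ) / (N : ℝ) : ℝ) : ℂ) * a k) atTop (𝓝 s) := by
  rw [← h.tsum_eq]
  have e : ∀ N : ℕ, ∑ k ∈ Finset.Icc (-(N : ℤ)) (N : ℤ),
      (((1 : ℝ) - (|k| : ℝ) / (N : ℝ) : ℝ) : ℂ) * a k
      = ∑' k : ℤ, if k ∈ Finset.Icc (-(N : ℤ)) (N : ℤ) then
        (((1 : ℝ) - (|k| : ℝ) / (N : ℝ) : ℝ) : ℂ) * a k else 0 := by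
    intro N
    rw [tsum_eq_sum (s := Finset.Icc (-(N : ℤ)) (N : ℤ))]
    · exact Finset.sum_congr rfl fun k hk => (if_pos hk).symm
    · intro k hk
      exact if_neg hk
  simp_rw [e]
  refine tendsto_tsum_of_dominated_convergence (bound := fun k => ‖a k‖) h.summable.norm ?_ ?_
  · intro k
    have h1 : Tendsto (fun N : ℕ => (((1 : ℝ) - (|k| : ℝ) / (N : ℝ) : ℝ) : ℂ) * a k) atTop (𝓝 (a k)) := by
      have : Tendsto (fun N : ℕ => (1 : ℝ) - (|k| : ℝ) / (N : ℝ)) atTop (𝓝 (1 - 0)) :=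
        tendsto_const_nhds.sub (tendsto_const_div_atTop_nhds_zero_nat _)
      have h2 := ((Complex.continuous_ofReal.tendsto _).comp this).mul_const (a k)
      simpa using h2
    refine h1.congr' ?_
    filter_upwards [eventually_ge_atTop k.natAbs] with N hN
    rw [if_pos]
    rw [Finset.mem_Icc]
    omega
  · refine Eventually.of_forall fun N k => ?_
    split_ifs with hk
    · rw [norm_mul, Complex.norm_real]
      refine mul_le_of_le_one_left (norm_nonneg _) ?_
      rw [Finset.mem_Icc] at hk
      have hkN : |(k : ℝ)| ≤ N := by
        rw [abs_le]
        exact ⟨by exact_mod_cast hk.1, by exact_mod_cast hk.2⟩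
      have h1 : |(k : ℝ)| / N ≤ 1 := div_le_one_of_le₀ hkN (by positivity)
      have h0 : 0 ≤ |(k : ℝ)| / N := by positivity
      rw [norm_eq_abs, abs_le]
      constructor <;> linarith
    · simp

end Mit

namespace Mit
open scoped FourierTransform

lemma c1_bdd {f : ℝ → ℝ} (hf : ContDiff ℝ 1 f) (hs : HasCompactSupport f)
    (hp : Function.support f ⊆ Ioi 0) :
    ∃ C, 0 ≤ C ∧ (∀ x, |deriv f x| ≤ C) ∧ (∀ z, |f (exp z) * exp (-z)| ≤ C) := by
  have hc : Continuous (deriv f) := hf.continuous_deriv le_rfl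
  obtain ⟨C, hC⟩ := hs.deriv.exists_bound_of_continuous hc
  have h0 : f 0 = 0 := by
    by_contra hne
    exact lt_irrefl (0 : ℝ) (hp hne)
  have hC0 : 0 ≤ C := (norm_nonneg _).trans (hC 0)
  refine ⟨C, hC0, hC, fun z => ?_⟩
  have := Convex.norm_image_sub_le_of_norm_deriv_le (f := f) (s := univ) (C := C) (x := 0) (y := exp z)
    (fun x _ => (hf.differentiable (by norm_num)).differentiableAt) (fun x _ => hC x) convex_univ
    (mem_univ _) (mem_univ _)
  rw [h0, sub_zero, sub_zero, norm_eq_abs, norm_eq_abs, abs_of_pos (exp_pos z)] at this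
  rw [abs_mul, abs_of_pos (exp_pos (-z))]
  calc |f (exp z)| * exp (-z) ≤ (C * exp z) * exp (-z) := by gcongr
    _ = C := by rw [mul_assoc, ← exp_add]; simp

lemma hs_congrC {f g : ℤ → ℂ} {a c : ℂ} (h : HasSum f a) (hfg : ∀ i, f i = g i) (hac : a = c) :
    HasSum g c := by
  obtain rfl : f = g := funext hfg
  exact hac ▸ h

variable {B U U' f : ℝ → ℝ}

lemma h_props (hB : Bhyp B) (hB2 : HypA2 B) (hU : Perron B U U') (hf : ContDiff ℝ 1 f)
    (hs : HasCompactSupport f) (hp : Function.support f ⊆ Ioi 0) :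
    ∃ (h' : ℝ → ℂ) (D : ℝ),
      (∀ u, HasDerivAt (fun u : ℝ => ((Wd U (u * Real.log 2) * (f (exp (u * Real.log 2))
        * exp (-(u * Real.log 2))) : ℝ) : ℂ)) (h' u) u) ∧ Continuous h' ∧
      (∀ u : ℝ, ‖((Wd U (u * Real.log 2) * (f (exp (u * Real.log 2))
        * exp (-(u * Real.log 2))) : ℝ) : ℂ)‖ ≤ D * exp (-(Real.log 2 * |u|))) ∧
      (∀ u, ‖h' u‖ ≤ D * exp (-(Real.log 2 * |u|))) := by
  have hL := log2_pos
  obtain ⟨C, hC0, hC1, hC2⟩ := c1_bdd hf hs hp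
  set L := Real.log 2 with hLdef
  set q : ℝ → ℝ := fun y => B (exp y) * Wd U y with hq
  have hq0 : ∀ y, 0 ≤ q y := fun y => mul_nonneg (hB.2.1 _ (exp_pos _)) (Wd_nonneg hU y)
  obtain ⟨C3, hC30, hC3⟩ := decay_of (fun y => Wd_nonneg hU y) (Wd_exp_bdd hU)
  obtain ⟨C4, hC40, hC4⟩ := decay_of hq0 (bWd_exp_bdd hB hB2 hU)
  set g : ℝ → ℝ := fun z => f (exp z) * exp (-z) with hg
  set g' : ℝ → ℝ := fun z => deriv f (exp z) - g z with hg'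
  have hWc : Continuous (Wd U) :=
    continuous_iff_continuousAt.2 fun u => (Wd_deriv hU u).continuousAt
  have hBc : Continuous (fun y => B (exp y)) :=
    hB.1.comp_continuous continuous_exp (fun y => exp_pos y)
  have hqc : Continuous q := hBc.mul hWc
  have hgc : Continuous g := (hf.continuous.comp continuous_exp).mul (continuous_exp.comp continuous_neg)
  have hg'c : Continuous g' :=
    ((hf.continuous_deriv le_rfl).comp continuous_exp).sub hgc
  have hgd : ∀ z, HasDerivAt g (g' z) z := by
    intro z
    have h1 : HasDerivAt f (deriv f (exp z)) (exp z) :=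
      ((hf.differentiable (by norm_num)).differentiableAt).hasDerivAt
    have h2 := (h1.comp z (Real.hasDerivAt_exp z)).mul ((Real.hasDerivAt_exp (-z)).comp z (hasDerivAt_neg z))
    refine HasDerivAt.congr_deriv h2 ?_
    simp only [hg', hg, Function.comp]
    have : exp z * exp (-z) = 1 := by rw [← exp_add]; simp
    linear_combination (deriv f (exp z)) * this
  set H : ℝ → ℝ := fun z => (q (z + L) - q z) * g z + Wd U z * g' z with hH
  have hHc : Continuous H := by fun_prop
  have hWg : ∀ z, HasDerivAt (fun z => Wd U z * g z) (H z) z := fun z => (Wd_deriv hU z).mul (hgd z)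
  have he : ∀ u : ℝ, exp (-|u * L|) = exp (-(L * |u|)) := by
    intro u; rw [abs_mul, abs_of_pos hL, mul_comm]
  set E := C4 * exp L + C4 with hE
  have hE0 : 0 ≤ E := by positivity
  have hHb : ∀ z, |H z| ≤ (E * C + C3 * (2 * C)) * exp (-|z|) := by
    intro z
    have hq1 : q (z + L) ≤ C4 * exp L * exp (-|z|) := by
      refine (hC4 _).trans ?_
      rw [mul_assoc, ← exp_add]
      refine mul_le_mul_of_nonneg_left (exp_le_exp.2 ?_) hC40
      have := abs_add_le (z + L) (-L)
      rw [add_neg_cancel_right, abs_neg, abs_of_pos hL] at this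
      linarith
    have hd : |q (z + L) - q z| ≤ E * exp (-|z|) := by
      have a1 := hC4 z
      have a2 := hq0 z
      have a3 := hq0 (z + L)
      rw [hE, add_mul, abs_le]
      constructor <;> nlinarith [mul_nonneg (mul_nonneg hC40 (exp_pos L).le) (exp_pos (-|z|)).le]
    have hg'b : |g' z| ≤ 2 * C := by
      have := abs_sub (deriv f (exp z)) (g z)
      have a1 := hC1 (exp z)
      have a2 := hC2 z
      simp only [hg'] 
      simp only [hg] at this ⊢
      linarith
    calc |H z| ≤ |(q (z + L) - q z) * g z| + |Wd U z * g' z| := abs_add_le _ _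
      _ ≤ (E * exp (-|z|)) * C + (C3 * exp (-|z|)) * (2 * C) := by
        rw [abs_mul _ (g z), abs_mul (Wd U z), abs_of_nonneg (Wd_nonneg hU z)]
        have a2 : |g z| ≤ C := hC2 z
        have a3 := hC3 z
        gcongr
      _ = _ := by ring
  refine ⟨fun u => ((L * H (u * L) : ℝ) : ℂ), max (C3 * C) (L * (E * C + C3 * (2 * C))), ?_, ?_, ?_, ?_⟩
  · intro u
    have h1 := (hWg (u * L)).comp u ((hasDerivAt_id u).mul_const L)
    have h2 := h1.ofReal_comp
    refine HasDerivAt.congr_deriv h2 ?_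
    congr 1
    ring
  · fun_prop
  · intro u
    rw [Complex.norm_real, norm_eq_abs, abs_mul, abs_of_nonneg (Wd_nonneg hU _), ← he]
    have a2 := hC2 (u * L)
    have a3 := hC3 (u * L)
    calc _ ≤ (C3 * exp (-|u * L|)) * C := by gcongr
      _ = (C3 * C) * exp (-|u * L|) := by ring
      _ ≤ _ := by gcongr; exact le_max_left _ _
  · intro u
    rw [Complex.norm_real, norm_eq_abs, abs_mul, abs_of_pos hL, ← he]
    calc _ ≤ L * ((E * C + C3 * (2 * C)) * exp (-|u * L|)) := by gcongr; exact hHb _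
      _ = (L * (E * C + C3 * (2 * C))) * exp (-|u * L|) := by ring
      _ ≤ _ := by gcongr; exact le_max_right _ _

/-- the rescaled weight in logarithmic coordinates -/
def hh (U f : ℝ → ℝ) (u : ℝ) : ℂ :=
  ((Wd U (u * Real.log 2) * (f (exp (u * Real.log 2)) * exp (-(u * Real.log 2))) : ℝ) : ℂ)

lemma nuk_eq (U f : ℝ → ℝ) (k : ℤ) : nuk U k (fun y => (f y : ℂ)) = 𝓕 (hh U f) (k : ℝ) := by
  have hL := log2_pos
  rw [nuk, integral_exp_cov, Real.fourier_real_eq_integral_exp_smul]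
  have := Measure.integral_comp_mul_right (fun y : ℝ => Real.exp y • (Uk U k (Real.exp y) * (f (Real.exp y) : ℂ))) (Real.log 2)
  rw [abs_of_pos (inv_pos.2 hL)] at this
  have h2 : ∫ y : ℝ, Real.exp y • (Uk U k (Real.exp y) * (f (Real.exp y) : ℂ)) = Real.log 2 •
      ∫ x : ℝ, Real.exp (x * Real.log 2) • (Uk U k (Real.exp (x * Real.log 2))
        * (f (Real.exp (x * Real.log 2)) : ℂ)) := by
    rw [this, smul_smul, mul_inv_cancel₀ hL.ne', one_smul]
  rw [h2, ← integral_smul]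
  congr 1
  funext u
  have hE : ((exp (u * Real.log 2) : ℝ) : ℂ) = ((exp (2 * (u * Real.log 2)) : ℝ) : ℂ)
      * ((exp (-(u * Real.log 2)) : ℝ) : ℂ) := by
    rw [← Complex.ofReal_mul, ← exp_add]
    congr 2
    ring
  have hX : Complex.exp (-(Complex.I * ((2 * (k : ℝ) * Real.pi / Real.log 2 : ℝ) : ℂ))
      * ((u * Real.log 2 : ℝ) : ℂ)) = Complex.exp (((-2 * π * u * (k : ℝ) : ℝ) : ℂ) * Complex.I) := by
    have hLc : ((Real.log 2 : ℝ) : ℂ) ≠ 0 := Complex.ofReal_ne_zero.2 hL.ne'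
    congr 1
    push_cast
    field_simp
  rw [hh, Wd, Uk, Real.log_exp, hX, Complex.real_smul, Complex.real_smul, smul_eq_mul, hE]
  push_cast
  ring

lemma phik_int (μ : Measure ℝ) (k : ℤ) :
    ∫ x in Ioi 0, phik k x ∂μ
      = ∫ y, Complex.exp (((2 * π * k * (y / Real.log 2) : ℝ) : ℂ) * Complex.I) ∂(nu μ) := by
  rw [nu_int μ (F := fun y : ℝ => Complex.exp (((2 * π * k * (y / Real.log 2) : ℝ) : ℂ) * Complex.I))
    (Continuous.stronglyMeasurable (by fun_prop))]
  congr 1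
  funext x
  rw [phik, Complex.real_smul]
  congr 2
  push_cast
  ring

lemma fejer_one (hB : Bhyp B) (hB2 : HypA2 B) (hU : Perron B U U') {μ : Measure ℝ}
    (hμ : (∫⁻ x in Ioi 0, ENNReal.ofReal x ∂μ) < ⊤) (hf : ContDiff ℝ 1 f)
    (hs : HasCompactSupport f) (hp : Function.support f ⊆ Ioi 0) (t : ℝ) :
    HasSum (fun k : ℤ => (∫ x in Ioi 0, phik k x ∂μ) * nuk U k (fun y => (f y : ℂ))
      * Complex.exp (Complex.I * ((2 * (k : ℝ) * Real.pi * t / Real.log 2 : ℝ) : ℂ)))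
      ((∫ x in Ioi 0, f x ∂(rho (Wd U) (Real.log 2) μ t) : ℝ) : ℂ) := by
  have hL := log2_pos
  have := nu_finite hμ
  obtain ⟨C, hC0, hC1, hC2⟩ := c1_bdd hf hs hp
  obtain ⟨h', D, p1, p2, p3, p4⟩ := h_props hB hB2 hU hf hs hp
  have hW := mkHypW hB hB2 hU
  rw [rho_int hW hμ hf.continuous.continuousOn hC2 t, ← integral_complex_ofReal]
  have hsum := four_sum (h := hh U f) hL p1 p2 p3 p4
  have hpt : ∀ x : ℝ, HasSum (fun n : ℤ => 𝓕 (hh U f) n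
      * Complex.exp (((2 * π * n * (x / Real.log 2) : ℝ) : ℂ) * Complex.I))
      ((Av (Wd U) (Real.log 2) (fun z => f (exp z) * exp (-z)) x : ℝ) : ℂ) := by
    intro x
    have h1 := poisson (h := hh U f) hL p1 p2 p3 p4 (x / Real.log 2)
    refine hs_congrC h1 (fun i => rfl) ?_
    rw [Av, Complex.ofReal_tsum]
    refine tsum_congr fun n => ?_
    rw [hh]
    have : (x / Real.log 2 + n) * Real.log 2 = x + n * Real.log 2 := by field_simp
    rw [this]
  have hI := hasSum_integral_of_dominated_convergence (μ := nu μ)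
    (F := fun (n : ℤ) (y : ℝ) => 𝓕 (hh U f) n
      * Complex.exp (((2 * π * n * ((y + t) / Real.log 2) : ℝ) : ℂ) * Complex.I))
    (f := fun y => ((Av (Wd U) (Real.log 2) (fun z => f (exp z) * exp (-z)) (y + t) : ℝ) : ℂ))
    (fun n _ => ‖𝓕 (hh U f) n‖)
    (fun n => (Continuous.stronglyMeasurable (by fun_prop)).aestronglyMeasurable)
    (fun n => Eventually.of_forall fun y => by
      rw [norm_mul, Complex.norm_exp_ofReal_mul_I, mul_one])
    (Eventually.of_forall fun y => hsum.norm)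
    (integrable_const _)
    (Eventually.of_forall fun y => hpt (y + t))
  refine hs_congrC hI (fun k => ?_) rfl
  rw [phik_int, nuk_eq]
  have e : ∫ y : ℝ, Complex.exp (((2 * π * k * ((y + t) / Real.log 2) : ℝ) : ℂ) * Complex.I) ∂(nu μ)
      = (∫ y : ℝ, Complex.exp (((2 * π * k * (y / Real.log 2) : ℝ) : ℂ) * Complex.I) ∂(nu μ))
        * Complex.exp (Complex.I * ((2 * (k : ℝ) * Real.pi * t / Real.log 2 : ℝ) : ℂ)) := by
    rw [← integral_mul_const]
    congr 1
    funext y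
    rw [← Complex.exp_add]
    congr 1
    push_cast
    ring
  rw [integral_const_mul, e]
  ring

end Mit

namespace Mit
lemma periodic_zero {d : ℝ → ℝ} {L : ℝ} (hL : 0 < L) (hp : ∀ t ≥ 0, d (t + L) = d t)
    (h0 : Tendsto d atTop (𝓝 0)) : ∀ t ≥ 0, d t = 0 := by
  intro t ht
  have h1 : ∀ n : ℕ, d (t + n * L) = d t := by
    intro n
    induction n with
    | zero => simp
    | succ n ih =>
      rw [← ih, ← hp (t + n * L) (by positivity)]
      congr 1
      push_cast
      ring
  have h2 : Tendsto (fun n : ℕ => t + n * L) atTop atTop :=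
    tendsto_atTop_add_const_left _ _ (tendsto_natCast_atTop_atTop.atTop_mul_const hL)
  have h3 := h0.comp h2
  refine tendsto_nhds_unique (tendsto_const_nhds (x := d t) (f := (atTop : Filter ℕ))) (h3.congr fun n => ?_)
  exact h1 n
end Mit

/-- Asymptotic oscillations for measure solutions: for `µ₀ = µ₀⁺ - µ₀⁻` a weighted signed measure
and `µ_t = µ₀⁺M_t - µ₀⁻M_t`, there is a `log 2`-periodic family of weighted signed measures
`ρ_t = ρ_t⁺ - ρ_t⁻` such that `e^{-t}µ_t(f) - ρ_t(f) → 0` for every `f ∈ Ċ₀`; this family is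
unique (in action on `Ċ₀`), and `ρ_t(f)` is given by the Fejér-type sum
`lim_N Σ (1-|k|/N) µ₀(φ_k) ν_k(f) e^{2ikπt/log 2}` for `f ∈ C¹_c(0,∞)`. -/
theorem stmt16 (B : ℝ → ℝ) (hB : Bhyp B) (hB2 : HypA2 B)
    (U U' : ℝ → ℝ) (hU : Perron B U U')
    (M : (ℝ → ℝ) → ℝ → ℝ → ℝ)
    (hM : ∀ g, LocBddOn g → LocBdd2 (M g) ∧ IsMildSol B g (M g))
    (μp μm : Measure ℝ)
    (hμp : (∫⁻ x in Ioi 0, ENNReal.ofReal x ∂μp) < ⊤)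
    (hμm : (∫⁻ x in Ioi 0, ENNReal.ofReal x ∂μm) < ⊤) :
    ∃ ρp ρm : ℝ → Measure ℝ,
      (∀ t ≥ 0, (∫⁻ x in Ioi 0, ENNReal.ofReal x ∂(ρp t)) < ⊤ ∧
        (∫⁻ x in Ioi 0, ENNReal.ofReal x ∂(ρm t)) < ⊤) ∧
      (∀ t ≥ 0, ρp (t + Real.log 2) = ρp t ∧ ρm (t + Real.log 2) = ρm t) ∧
      (∀ f : ℝ → ℝ, ContinuousOn f (Ioi 0) →
        Tendsto (fun x => f x / x) (nhdsWithin 0 (Ioi 0)) (nhds 0) →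
        Tendsto (fun x => f x / x) atTop (nhds 0) →
        Tendsto (fun t =>
            exp (-t) * ((∫ x in Ioi 0, M f t x ∂μp) - ∫ x in Ioi 0, M f t x ∂μm)
              - ((∫ x in Ioi 0, f x ∂(ρp t)) - ∫ x in Ioi 0, f x ∂(ρm t)))
          atTop (nhds 0)) ∧
      (∀ ρp' ρm' : ℝ → Measure ℝ,
        (∀ t ≥ 0, (∫⁻ x in Ioi 0, ENNReal.ofReal x ∂(ρp' t)) < ⊤ ∧
          (∫⁻ x in Ioi 0, ENNReal.ofReal x ∂(ρm' t)) < ⊤) →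
        (∀ t ≥ 0, ∀ f : ℝ → ℝ, Measurable f → (∃ C, ∀ x > 0, |f x| ≤ C * x) →
          (∫ x in Ioi 0, f x ∂(ρp' (t + Real.log 2))) - (∫ x in Ioi 0, f x ∂(ρm' (t + Real.log 2)))
            = (∫ x in Ioi 0, f x ∂(ρp' t)) - ∫ x in Ioi 0, f x ∂(ρm' t)) →
        (∀ f : ℝ → ℝ, ContinuousOn f (Ioi 0) →
          Tendsto (fun x => f x / x) (nhdsWithin 0 (Ioi 0)) (nhds 0) →
          Tendsto (fun x => f x / x) atTop (nhds 0) →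
          Tendsto (fun t =>
              exp (-t) * ((∫ x in Ioi 0, M f t x ∂μp) - ∫ x in Ioi 0, M f t x ∂μm)
                - ((∫ x in Ioi 0, f x ∂(ρp' t)) - ∫ x in Ioi 0, f x ∂(ρm' t)))
            atTop (nhds 0)) →
        ∀ t ≥ 0, ∀ f : ℝ → ℝ, ContinuousOn f (Ioi 0) →
          Tendsto (fun x => f x / x) (nhdsWithin 0 (Ioi 0)) (nhds 0) →
          Tendsto (fun x => f x / x) atTop (nhds 0) →
          (∫ x in Ioi 0, f x ∂(ρp' t)) - (∫ x in Ioi 0, f x ∂(ρm' t))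
            = (∫ x in Ioi 0, f x ∂(ρp t)) - ∫ x in Ioi 0, f x ∂(ρm t)) ∧
      (∀ t ≥ 0, ∀ f : ℝ → ℝ, ContDiff ℝ 1 f → HasCompactSupport f →
        Function.support f ⊆ Ioi 0 →
        Tendsto (fun N : ℕ => ∑ k ∈ Finset.Icc (-(N : ℤ)) (N : ℤ),
            (((1 : ℝ) - (|k| : ℝ) / (N : ℝ) : ℝ) : ℂ)
              * ((∫ x in Ioi 0, phik k x ∂μp) - ∫ x in Ioi 0, phik k x ∂μm)
              * nuk U k (fun y => (f y : ℂ))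
              * Complex.exp (Complex.I * ((2 * (k : ℝ) * Real.pi * t / Real.log 2 : ℝ) : ℂ)))
          atTop
          (nhds ((((∫ x in Ioi 0, f x ∂(ρp t)) - ∫ x in Ioi 0, f x ∂(ρm t) : ℝ)) : ℂ))) := by
  have hW := Mit.mkHypW hB hB2 hU
  have hD := Mit.mkHypD hB hB2 hU
  have hL := Mit.log2_pos
  have hconv : ∀ f : ℝ → ℝ, ContinuousOn f (Ioi 0) →
        Tendsto (fun x => f x / x) (nhdsWithin 0 (Ioi 0)) (nhds 0) →
        Tendsto (fun x => f x / x) atTop (nhds 0) →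
        Tendsto (fun t =>
            exp (-t) * ((∫ x in Ioi 0, M f t x ∂μp) - ∫ x in Ioi 0, M f t x ∂μm)
              - ((∫ x in Ioi 0, f x ∂(Mit.rho (Mit.Wd U) (Real.log 2) μp t))
                - ∫ x in Ioi 0, f x ∂(Mit.rho (Mit.Wd U) (Real.log 2) μm t)))
          atTop (nhds 0) := by
    intro f hf h0 h1
    obtain ⟨C, hC⟩ := Mit.g_bdd hf h0 h1
    obtain ⟨hm1, hm2⟩ := hM f (Mit.f_locBdd hC).2
    have a := (Mit.conv_one hD hm1 hm2 hf hC hμp).sub (Mit.conv_one hD hm1 hm2 hf hC hμm)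
    rw [sub_zero] at a
    refine a.congr fun t => ?_
    ring
  refine ⟨Mit.rho (Mit.Wd U) (Real.log 2) μp, Mit.rho (Mit.Wd U) (Real.log 2) μm,
    fun t _ => ⟨Mit.rho_finite hW hμp t, Mit.rho_finite hW hμm t⟩,
    fun t _ => ⟨Mit.rho_periodic _ _ _ t, Mit.rho_periodic _ _ _ t⟩, hconv, ?_, ?_⟩
  · intro ρp' ρm' _ hper hconv' t ht f hf h0 h1
    obtain ⟨C, hC⟩ := Mit.g_bdd hf h0 h1
    have hfb := (Mit.f_locBdd hC).1
    have hgm : Measurable ((Ioi (0 : ℝ)).indicator f) := by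
      have := hf.measurable_piecewise (continuousOn_const (c := (0 : ℝ))) measurableSet_Ioi
      exact (congrArg Measurable Set.piecewise_eq_indicator).mp this
    have hind : ∀ m : Measure ℝ, ∫ x in Ioi 0, (Ioi (0 : ℝ)).indicator f x ∂m = ∫ x in Ioi 0, f x ∂m :=
      fun m => setIntegral_congr_fun measurableSet_Ioi fun x hx => indicator_of_mem hx f
    have hgb : ∃ C, ∀ x > 0, |(Ioi (0 : ℝ)).indicator f x| ≤ C * x :=
      ⟨C, fun x hx => by rw [indicator_of_mem (mem_Ioi.2 hx)]; exact hfb x hx⟩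
    have key := Mit.periodic_zero (d := fun t =>
        ((∫ x in Ioi 0, f x ∂(ρp' t)) - (∫ x in Ioi 0, f x ∂(ρm' t)))
        - ((∫ x in Ioi 0, f x ∂(Mit.rho (Mit.Wd U) (Real.log 2) μp t))
                - ∫ x in Ioi 0, f x ∂(Mit.rho (Mit.Wd U) (Real.log 2) μm t))) hL ?_ ?_ t ht
    · exact sub_eq_zero.1 key
    · intro s hs
      have := hper s hs _ hgm hgb
      simp only [hind] at this
      simp only [this, Mit.rho_periodic]
    · have a := (hconv f hf h0 h1).sub (hconv' f hf h0 h1)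
      rw [sub_zero] at a
      refine a.congr fun t => ?_
      ring
  · intro t _ f hf hs hp
    have a := Mit.cesaro ((Mit.fejer_one hB hB2 hU hμp hf hs hp t).sub
      (Mit.fejer_one hB hB2 hU hμm hf hs hp t))
    rw [← Complex.ofReal_sub] at a
    refine a.congr fun N => ?_
    refine Finset.sum_congr rfl fun k _ => ?_
    ring
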